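/- arXiv:2510.25104 — 6 statements merged into one kernel-verified Lean document; each statement's English description precedes it below -/
import Mathlib

section
/- For every nonnegative integer n, G_2(n) = (G(n) + (-1)^n · H(n))/2, where G_2(n) counts the partitions counted by G(n) having an even number of blue parts. -/
noncomputable section

/-- Overpartitions of `n`: the first component is the set of overlined parts
(at most one overlined part of each size), the second is the multiset of
non-overlined parts; all parts are positive and the total sum is `n`. -/
def overpartitions (n : ℕ) : Set (Finset ℕ × Multiset ℕ) :=
  {p | (∀ x ∈ p.1, 0 < x) ∧ (∀ x ∈ p.2, 0 < x) ∧ p.1.sum id + p.2.sum = n}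

/-- `p̄(n)`, the number of overpartitions of `n`. -/
def pbar (n : ℕ) : ℕ := (overpartitions n).ncard

/-- Overpartitions of `n` into odd parts. -/
def overpartitionsOdd (n : ℕ) : Set (Finset ℕ × Multiset ℕ) :=
  {p | p ∈ overpartitions n ∧ (∀ x ∈ p.1, Odd x) ∧ ∀ x ∈ p.2, Odd x}

/-- `p̄_o(n)`, the number of overpartitions of `n` into odd parts. -/
def pbarOdd (n : ℕ) : ℕ := (overpartitionsOdd n).ncard

/-- Two-color partitions of `n` (first component: blue parts, second: green
parts) in which even parts may occur only in the blue color, i.e. all green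
parts are odd. -/
def FSet (n : ℕ) : Set (Multiset ℕ × Multiset ℕ) :=
  {p | (∀ x ∈ p.1, 0 < x) ∧ (∀ x ∈ p.2, 0 < x) ∧ p.1.sum + p.2.sum = n ∧
    ∀ x ∈ p.2, Odd x}

/-- `F(n)`. -/
def Fcount (n : ℕ) : ℕ := (FSet n).ncard

/-- The number of even parts of a multiset of naturals. -/
def evenParts (m : Multiset ℕ) : ℕ := Multiset.card (m.filter (fun x => Even x))

/-- `F₀(n)`: partitions counted by `F(n)` with an even number of even parts. -/
def F0 (n : ℕ) : ℕ := {p ∈ FSet n | Even (evenParts (p.1 + p.2))}.ncard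

/-- `F₁(n)`: partitions counted by `F(n)` with an odd number of even parts. -/
def F1 (n : ℕ) : ℕ := {p ∈ FSet n | Odd (evenParts (p.1 + p.2))}.ncard

/-- `F₂(n)`: partitions counted by `F(n)` with an even number of parts. -/
def F2 (n : ℕ) : ℕ := {p ∈ FSet n | Even (Multiset.card (p.1 + p.2))}.ncard

/-- `F₃(n)`: partitions counted by `F(n)` with an odd number of parts. -/
def F3 (n : ℕ) : ℕ := {p ∈ FSet n | Odd (Multiset.card (p.1 + p.2))}.ncard

/-- Partitions counted by `F(n)` whose blue parts are distinct odd numbers. -/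
def QSet (n : ℕ) : Set (Multiset ℕ × Multiset ℕ) :=
  {p | p ∈ FSet n ∧ (∀ x ∈ p.1, Odd x) ∧ p.1.Nodup}

/-- `Q(n)`. -/
def Qcount (n : ℕ) : ℕ := (QSet n).ncard

/-- Two-color partitions of `n` (first component: blue parts, second: green
parts) in which odd parts may occur only in the blue color, i.e. all green
parts are even. -/
def GSet (n : ℕ) : Set (Multiset ℕ × Multiset ℕ) :=
  {p | (∀ x ∈ p.1, 0 < x) ∧ (∀ x ∈ p.2, 0 < x) ∧ p.1.sum + p.2.sum = n ∧
    ∀ x ∈ p.2, Even x}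

/-- `G(n)`. -/
def Gcount (n : ℕ) : ℕ := (GSet n).ncard

/-- `G₀(n)`: partitions counted by `G(n)` with an even number of blue even parts. -/
def G0 (n : ℕ) : ℕ := {p ∈ GSet n | Even (evenParts p.1)}.ncard

/-- `G₁(n)`: partitions counted by `G(n)` with an odd number of blue even parts. -/
def G1 (n : ℕ) : ℕ := {p ∈ GSet n | Odd (evenParts p.1)}.ncard

/-- `G₂(n)`: partitions counted by `G(n)` with an even number of blue parts. -/
def G2 (n : ℕ) : ℕ := {p ∈ GSet n | Even (Multiset.card p.1)}.ncard

/-- `G₃(n)`: partitions counted by `G(n)` with an odd number of blue parts. -/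
def G3 (n : ℕ) : ℕ := {p ∈ GSet n | Odd (Multiset.card p.1)}.ncard

/-- `G₄(n)`: partitions counted by `G(n)` with an even total number of parts. -/
def G4 (n : ℕ) : ℕ := {p ∈ GSet n | Even (Multiset.card (p.1 + p.2))}.ncard

/-- `G₅(n)`: partitions counted by `G(n)` with an odd total number of parts. -/
def G5 (n : ℕ) : ℕ := {p ∈ GSet n | Odd (Multiset.card (p.1 + p.2))}.ncard

/-- Partitions of `n` in which the odd parts are distinct. -/
def HSet (n : ℕ) : Set (Multiset ℕ) :=
  {m | (∀ x ∈ m, 0 < x) ∧ m.sum = n ∧ (m.filter (fun x => Odd x)).Nodup}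

/-- `H(n)`. -/
def Hcount (n : ℕ) : ℕ := (HSet n).ncard

/-- Partitions of `n` into distinct parts whose even parts are all
congruent to `2` modulo `4`. -/
def KSet (n : ℕ) : Set (Finset ℕ) :=
  {s | (∀ x ∈ s, 0 < x) ∧ s.sum id = n ∧ ∀ x ∈ s, Even x → x % 4 = 2}

/-- `K(n)`: the signed count of partitions in `KSet n`, each weighted by
`(-1)^j` where `j` is the number of even parts. -/
def Kcount (n : ℕ) : ℤ :=
  ({s ∈ KSet n | Even (s.filter (fun x => Even x)).card}.ncard : ℤ) -
  ({s ∈ KSet n | Odd (s.filter (fun x => Even x)).card}.ncard : ℤ)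

/-- Partitions counted by `G(n)` whose blue parts are distinct odd numbers. -/
def RSet (n : ℕ) : Set (Multiset ℕ × Multiset ℕ) :=
  {p | p ∈ GSet n ∧ (∀ x ∈ p.1, Odd x) ∧ p.1.Nodup}

/-- `R(n)`. -/
def Rcount (n : ℕ) : ℕ := (RSet n).ncard

/-- Two-color partitions of `n` in which all parts of the same color are
distinct and odd parts may occur only in the blue color: the first component
is the (finite) set of blue parts (distinct positive integers), the second the
set of green parts (distinct positive even integers). -/
def LSet (n : ℕ) : Set (Finset ℕ × Finset ℕ) :=
  {p | (∀ x ∈ p.1, 0 < x) ∧ (∀ x ∈ p.2, 0 < x ∧ Even x) ∧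
    p.1.sum id + p.2.sum id = n}

/-- `L₀(n)`: partitions counted by `L(n)` with an even number of blue even parts. -/
def L0 (n : ℕ) : ℕ := {p ∈ LSet n | Even (p.1.filter (fun x => Even x)).card}.ncard

/-- `L₁(n)`: partitions counted by `L(n)` with an odd number of blue even parts. -/
def L1 (n : ℕ) : ℕ := {p ∈ LSet n | Odd (p.1.filter (fun x => Even x)).card}.ncard

/-- `L₂(n)`: partitions counted by `L(n)` with an even number of blue parts. -/
def L2 (n : ℕ) : ℕ := {p ∈ LSet n | Even p.1.card}.ncard

/-- `L₃(n)`: partitions counted by `L(n)` with an odd number of blue parts. -/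
def L3 (n : ℕ) : ℕ := {p ∈ LSet n | Odd p.1.card}.ncard

theorem bit_add (c v w : ℕ) (h : c.testBit v = false) :
    (c + 2 ^ v).testBit w = if w = v then true else c.testBit w := by
  have e : c + 2 ^ v = c ^^^ 2 ^ v := by
    · have hc : c = 2 ^ (v + 1) * (c / 2 ^ (v + 1)) + c % 2 ^ (v + 1) :=
        (Nat.div_add_mod c _).symm
      have hm : c % 2 ^ (v + 1) < 2 ^ v := by
        rw [Nat.testBit_eq_decide_div_mod_eq] at h
        have h3 : c / 2 ^ v % 2 = 0 := by
          have := of_decide_eq_false h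
          omega
        rw [Nat.pow_succ, Nat.mod_mul, h3]
        simpa using Nat.mod_lt c (by positivity)
      have hs : c % 2 ^ (v + 1) + 2 ^ v < 2 ^ (v + 1) := by have h9 : 2 ^ (v + 1) = 2 ^ v * 2 := pow_succ 2 v; omega
      apply Nat.eq_of_testBit_eq
      intro i
      have e1 : c + 2 ^ v = 2 ^ (v + 1) * (c / 2 ^ (v + 1)) + (c % 2 ^ (v + 1) + 2 ^ v) := by
        omega
      rw [e1, Nat.testBit_two_pow_mul_add _ hs, Nat.testBit_xor, Nat.testBit_two_pow]
      have e2 : c % 2 ^ (v + 1) + 2 ^ v = 2 ^ v * 1 + c % 2 ^ (v + 1) := by ring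
      rw [e2, Nat.testBit_two_pow_mul_add _ hm]
      by_cases hi : i < v
      · have : v ≠ i := by omega
        simp [hi, this, show i < v + 1 by omega]
      · by_cases hi2 : i = v
        · subst hi2; simp [h]
        · have : v ≠ i := by omega
          rw [if_neg (by omega), Nat.testBit_div_two_pow]
          simp [this, show i - (v + 1) + (v + 1) = i by omega]
  rw [e, Nat.testBit_xor, Nat.testBit_two_pow]
  by_cases hw : w = v
  · subst hw; simp [h]
  · simp [hw, Ne.symm hw]

theorem bit_sub (c v w : ℕ) (h : c.testBit v = true) :
    (c - 2 ^ v).testBit w = if w = v then false else c.testBit w := by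
  have hle := Nat.ge_two_pow_of_testBit h
  obtain ⟨d, rfl⟩ := Nat.exists_eq_add_of_le hle
  rw [Nat.testBit_two_pow_add_eq] at h
  have hd : d.testBit v = false := by simpa using h
  rw [Nat.add_sub_cancel_left, add_comm, bit_add d v w hd]
  by_cases hw : w = v
  · subst hw; simp [hd]
  · simp [hw]

def vv (e : ℕ) : ℕ := e.factorization 2
def jj (e : ℕ) : ℕ := e / 2 ^ e.factorization 2

theorem vj (e : ℕ) : 2 ^ vv e * jj e = e := Nat.ordProj_mul_ordCompl_eq_self e 2

theorem jj_odd (e : ℕ) (h : 0 < e) : Odd (jj e) := by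
  have := Nat.not_dvd_ordCompl Nat.prime_two (n := e) (by omega)
  rw [← Nat.not_even_iff_odd, even_iff_two_dvd]
  exact this

theorem vv_pos (e : ℕ) (h : 0 < e) (he : Even e) : 0 < vv e := by
  rcases Nat.eq_zero_or_pos (vv e) with h0 | h0
  · have h1 := vj e
    rw [h0] at h1
    have h2 := jj_odd e h
    rw [show jj e = e by omega, ← Nat.not_even_iff_odd] at h2
    exact absurd he h2
  · exact h0

/-- the toggle positions of a multiset -/
def SS (b : Multiset ℕ) : Set ℕ :=
  {e | 0 < e ∧ Even e ∧ (e ∈ b ∨ (b.count (jj e)).testBit (vv e) = true)}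

def tog (e : ℕ) (b : Multiset ℕ) : Multiset ℕ :=
  if (b.count (jj e)).testBit (vv e) = true then
    (b - Multiset.replicate (2 ^ vv e) (jj e)) + {e}
  else b.erase e + Multiset.replicate (2 ^ vv e) (jj e)

section
variable (e : ℕ) (b : Multiset ℕ) (he : e ∈ SS b)

theorem rep_le (h : (b.count (jj e)).testBit (vv e) = true) :
    Multiset.replicate (2 ^ vv e) (jj e) ≤ b :=
  Multiset.le_count_iff_replicate_le.1 (Nat.ge_two_pow_of_testBit h)

theorem tog_cases (he : e ∈ SS b) :
    ((b.count (jj e)).testBit (vv e) = true ∧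
      ∃ c, b = c + Multiset.replicate (2 ^ vv e) (jj e) ∧ tog e b = c + {e}) ∨
    ((b.count (jj e)).testBit (vv e) = false ∧
      ∃ c, b = c + {e} ∧ tog e b = c + Multiset.replicate (2 ^ vv e) (jj e)) := by
  by_cases h : (b.count (jj e)).testBit (vv e) = true
  · left
    refine ⟨h, b - Multiset.replicate (2 ^ vv e) (jj e), ?_, ?_⟩
    · exact (tsub_add_cancel_of_le (rep_le e b h)).symm
    · simp [tog, h]
  · right
    have hm : e ∈ b := by
      rcases he.2.2 with h' | h'
      · exact h'
      · exact absurd h' h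
    refine ⟨by simpa using h, b.erase e, ?_, ?_⟩
    · rw [add_comm, Multiset.singleton_add, Multiset.cons_erase hm]
    · simp [tog, h]

theorem tog_sum (he : e ∈ SS b) : (tog e b).sum = b.sum := by
  have := vj e
  rcases tog_cases e b he with ⟨_, c, h1, h2⟩ | ⟨_, c, h1, h2⟩ <;> rw [h2] <;>
    conv_rhs => rw [h1]
  · simp [this]
  · simp [this]

theorem tog_pos (he : e ∈ SS b) (hb : ∀ x ∈ b, 0 < x) : ∀ x ∈ tog e b, 0 < x := by
  have hj := (jj_odd e he.1).pos
  have h0 := he.1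
  rcases tog_cases e b he with ⟨_, c, h1, h2⟩ | ⟨_, c, h1, h2⟩ <;> rw [h2] <;> intro x hx <;>
    rw [Multiset.mem_add] at hx <;> rcases hx with hx | hx
  · exact hb x (by rw [h1]; simp [hx])
  · simp at hx; omega
  · exact hb x (by rw [h1]; simp [hx])
  · have := Multiset.eq_of_mem_replicate hx; omega

theorem tog_card (he : e ∈ SS b) :
    (-1 : ℤ) ^ Multiset.card (tog e b) = - (-1) ^ Multiset.card b := by
  have hv : Even (2 ^ vv e) := (Nat.even_pow.2 ⟨even_two, (vv_pos e he.1 he.2.1).ne'⟩)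
  rcases tog_cases e b he with ⟨_, c, h1, h2⟩ | ⟨_, c, h1, h2⟩ <;> rw [h2] <;>
    conv_rhs => rw [h1]
  · simp [pow_add, hv.neg_one_pow]
  · simp [pow_add, hv.neg_one_pow]

theorem jne (he : e ∈ SS b) (e' : ℕ) (h' : 0 < e') : jj e' ≠ e := by
  intro h
  have := jj_odd e' h'
  rw [h, ← Nat.not_even_iff_odd] at this
  exact this he.2.1

theorem tog_bit (he : e ∈ SS b) : ((tog e b).count (jj e)).testBit (vv e) =
    !((b.count (jj e)).testBit (vv e)) := by
  have hj := jne e b he e he.1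
  rcases tog_cases e b he with ⟨hb, c, h1, h2⟩ | ⟨hb, c, h1, h2⟩
  · have hc : (tog e b).count (jj e) = b.count (jj e) - 2 ^ vv e := by
      rw [h2]; conv_rhs => rw [h1]
      simp [hj]
    rw [hc, bit_sub _ _ _ hb, hb]; simp
  · have hc : (tog e b).count (jj e) = b.count (jj e) + 2 ^ vv e := by
      rw [h2]; conv_rhs => rw [h1]
      simp [hj]
    rw [hc, bit_add _ _ _ hb, hb]; simp

theorem tog_bit' (he : e ∈ SS b) (e' : ℕ) (h' : 0 < e') (hne : e' ≠ e) :
    ((tog e b).count (jj e')).testBit (vv e') = (b.count (jj e')).testBit (vv e') := by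
  have hj := jne e b he e' h'
  by_cases hjj : jj e' = jj e
  · have hv : vv e' ≠ vv e := by
      intro h
      apply hne
      rw [← vj e', ← vj e, h, hjj]
    rw [hjj] at hj ⊢
    rcases tog_cases e b he with ⟨hb, c, h1, h2⟩ | ⟨hb, c, h1, h2⟩
    · have hc : (tog e b).count (jj e) = b.count (jj e) - 2 ^ vv e := by
        rw [h2]; conv_rhs => rw [h1]
        simp [hj]
      rw [hc, bit_sub _ _ _ hb]; simp [hv]
    · have hc : (tog e b).count (jj e) = b.count (jj e) + 2 ^ vv e := by
        rw [h2]; conv_rhs => rw [h1]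
        simp [hj]
      rw [hc, bit_add _ _ _ hb]; simp [hv]
  · have hc : (tog e b).count (jj e') = b.count (jj e') := by
      rcases tog_cases e b he with ⟨hb, c, h1, h2⟩ | ⟨hb, c, h1, h2⟩ <;> rw [h2] <;>
        conv_rhs => rw [h1]
      · simp [hj, Multiset.count_replicate, Ne.symm hjj]
      · simp [hj, Multiset.count_replicate, Ne.symm hjj]
    rw [hc]

theorem tog_SS (he : e ∈ SS b) : SS (tog e b) = SS b := by
  ext e'
  by_cases hne : e' = e
  · subst hne
    refine iff_of_true ⟨he.1, he.2.1, ?_⟩ he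
    rw [tog_bit _ _ he]
    rcases tog_cases _ b he with ⟨hb, c, h1, h2⟩ | ⟨hb, c, h1, h2⟩
    · left; rw [h2]; simp
    · right; rw [hb]; simp
  · simp only [SS, Set.mem_ofPred_eq]
    refine and_congr_right fun h0 => and_congr_right fun h1 => ?_
    rw [tog_bit' e b he e' h0 hne]
    refine or_congr_left ?_
    have hj : e' ≠ jj e := by
      intro h
      have := jj_odd e he.1
      rw [← h, ← Nat.not_even_iff_odd] at this
      exact this h1
    rcases tog_cases _ b he with ⟨hb, c, h1, h2⟩ | ⟨hb, c, h1, h2⟩ <;> rw [h2] <;>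
      conv_rhs => rw [h1]
    · simp [hne, Multiset.mem_replicate, hj]
    · simp [hne, Multiset.mem_replicate, hj]

theorem tog_tog (he : e ∈ SS b) : tog e (tog e b) = b := by
  have hbit := tog_bit e b he
  have he2 : e ∈ SS (tog e b) := by rw [tog_SS e b he]; exact he
  rcases tog_cases e b he with ⟨hb, c, h1, h2⟩ | ⟨hb, c, h1, h2⟩ <;>
  rcases tog_cases e _ he2 with ⟨hb', c', h1', h2'⟩ | ⟨hb', c', h1', h2'⟩
  · rw [hbit, hb] at hb'; simp at hb'
  · rw [h2', h1]
    rw [h2] at h1'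
    rw [add_right_cancel h1']
  · rw [h2', h1]
    rw [h2] at h1'
    rw [add_right_cancel h1']
  · rw [hbit, hb] at hb'; simp at hb'

end

theorem SS_empty (b : Multiset ℕ) (hpos : ∀ x ∈ b, 0 < x) :
    SS b = ∅ ↔ (∀ x ∈ b, Odd x) ∧ b.Nodup := by
  constructor
  · intro h
    have h1 : ∀ x ∈ b, Odd x := by
      intro x hx
      by_contra hc
      have : x ∈ SS b := ⟨hpos x hx, Nat.not_odd_iff_even.1 hc, Or.inl hx⟩
      rw [h] at this
      exact this
    refine ⟨h1, ?_⟩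
    rw [Multiset.nodup_iff_count_le_one]
    intro j
    by_contra hc
    have hc2 : b.count j ≥ 2 ^ 1 := by omega
    have hj : Odd j := h1 j (Multiset.count_pos.1 (by omega))
    obtain ⟨i, hi, hbit⟩ := Nat.exists_ge_and_testBit_of_ge_two_pow hc2
    have hj0 := hj.pos
    have hf : (2 ^ i * j).factorization 2 = i := by
      rw [Nat.factorization_mul (by positivity) (by omega)]
      have : j.factorization 2 = 0 :=
        Nat.factorization_eq_zero_of_not_dvd (by rw [← even_iff_two_dvd, Nat.not_even_iff_odd]; exact hj)
      simp [this, Nat.prime_two.factorization_pow]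
    have : 2 ^ i * j ∈ SS b := by
      refine ⟨by positivity, ?_, Or.inr ?_⟩
      · exact (Nat.even_pow.2 ⟨even_two, by omega⟩).mul_right j
      · have hjj : jj (2 ^ i * j) = j := by
          unfold jj; rw [hf, Nat.mul_div_cancel_left _ (by positivity)]
        have hvv : vv (2 ^ i * j) = i := hf
        rw [hjj, hvv]; exact hbit
    rw [h] at this
    exact this
  · rintro ⟨h1, h2⟩
    rw [Set.eq_empty_iff_forall_notMem]
    rintro e ⟨h0, hev, h | h⟩
    · exact (Nat.not_even_iff_odd.2 (h1 e h)) hev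
    · have h3 := Nat.ge_two_pow_of_testBit h
      have h4 := Multiset.nodup_iff_count_le_one.1 h2 (jj e)
      have h5 : 2 ^ 1 ≤ 2 ^ vv e := Nat.pow_le_pow_right (by norm_num) (vv_pos e h0 hev)
      omega

theorem card_le_sum' (m : Multiset ℕ) (h : ∀ x ∈ m, 0 < x) : Multiset.card m ≤ m.sum := by
  simpa using Multiset.card_nsmul_le_sum (s := m) (a := 1) (fun x hx => h x hx)

theorem fin_ms (n : ℕ) : {m : Multiset ℕ | (∀ x ∈ m, 0 < x) ∧ m.sum ≤ n}.Finite := by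
  refine (Set.finite_Iic (n • Multiset.range (n + 1))).subset ?_
  rintro m ⟨h1, h2⟩
  rw [Set.mem_Iic, Multiset.le_iff_count]
  intro a
  by_cases ha : a ∈ m
  · have h3 := Multiset.le_sum_of_mem ha
    have h4 := Multiset.count_le_card a m
    have h5 := card_le_sum' m h1
    have h6 : (Multiset.range (n + 1)).count a = 1 :=
      Multiset.count_eq_one_of_mem (Multiset.nodup_range _) (Multiset.mem_range.2 (by omega))
    rw [Multiset.count_nsmul, h6]
    omega
  · simp [Multiset.count_eq_zero_of_notMem ha]

theorem GSet_fin (n : ℕ) : (GSet n).Finite := by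
  refine ((fin_ms n).prod (fin_ms n)).subset ?_
  rintro ⟨a, b⟩ ⟨h1, h2, h3, _⟩
  exact ⟨⟨h1, by simp at h3 ⊢; omega⟩, ⟨h2, by simp at h3 ⊢; omega⟩⟩

theorem R_eq_H (n : ℕ) : (RSet n).ncard = (HSet n).ncard := by
  have fe : ∀ m : Multiset ℕ, (∀ x ∈ m, Even x) → m.filter (fun x => Odd x) = 0 := by
    intro m hm
    rw [Multiset.filter_eq_nil]
    intro a ha
    exact Nat.not_odd_iff_even.2 (hm a ha)
  have fe' : ∀ m : Multiset ℕ, (∀ x ∈ m, Odd x) → m.filter (fun x => ¬ Odd x) = 0 := by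
    intro m hm
    rw [Multiset.filter_eq_nil]
    intro a ha
    simpa using hm a ha
  have fo : ∀ p ∈ RSet n, (p.1 + p.2).filter (fun x => Odd x) = p.1 := by
    rintro p ⟨hg, h1, h2⟩
    rw [Multiset.filter_add, fe p.2 hg.2.2.2, Multiset.filter_eq_self.2 h1, add_zero]
  have fo' : ∀ p ∈ RSet n, (p.1 + p.2).filter (fun x => ¬ Odd x) = p.2 := by
    rintro p ⟨hg, h1, h2⟩
    rw [Multiset.filter_add, fe' p.1 h1, Multiset.filter_eq_self.2, zero_add]
    intro a ha
    exact Nat.not_odd_iff_even.2 (hg.2.2.2 a ha)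
  refine Set.ncard_congr (fun p _ => p.1 + p.2) ?_ ?_ ?_
  · intro p hp
    refine ⟨?_, ?_, ?_⟩
    · intro x hx
      rcases Multiset.mem_add.1 hx with h | h
      · exact hp.1.1 x h
      · exact hp.1.2.1 x h
    · rw [Multiset.sum_add]; exact hp.1.2.2.1
    · rw [fo p hp]; exact hp.2.2
  · intro p q hp hq h
    ext1
    · rw [← fo p hp, ← fo q hq, h]
    · rw [← fo' p hp, ← fo' q hq, h]
  · rintro m ⟨h1, h2, h3⟩
    have hs : m.filter (fun x => Odd x) + m.filter (fun x => ¬ Odd x) = m :=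
      Multiset.filter_add_not _ _
    refine ⟨(m.filter (fun x => Odd x), m.filter (fun x => ¬ Odd x)), ⟨⟨?_, ?_, ?_, ?_⟩, ?_, ?_⟩, hs⟩
    · intro x hx; exact h1 x (Multiset.mem_of_mem_filter hx)
    · intro x hx; exact h1 x (Multiset.mem_of_mem_filter hx)
    · rw [← Multiset.sum_add, hs, h2]
    · intro x hx; exact Nat.not_odd_iff_even.1 (Multiset.mem_filter.1 hx).2
    · intro x hx; exact (Multiset.of_mem_filter hx)
    · exact h3

theorem sgn_sum (m : Multiset ℕ) (h : ∀ x ∈ m, Odd x) :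
    (-1 : ℤ) ^ Multiset.card m = (-1) ^ m.sum := by
  induction m using Multiset.induction_on with
  | empty => simp
  | cons a s ih =>
    rw [Multiset.card_cons, Multiset.sum_cons, pow_succ, pow_add,
      ih (fun x hx => h x (Multiset.mem_cons_of_mem hx)),
      (h a (Multiset.mem_cons_self a s)).neg_one_pow]
    ring

theorem sgn_even (m : Multiset ℕ) (h : ∀ x ∈ m, Even x) : (-1 : ℤ) ^ m.sum = 1 := by
  induction m using Multiset.induction_on with
  | empty => simp
  | cons a s ih =>
    rw [Multiset.sum_cons, pow_add,
      ih (fun x hx => h x (Multiset.mem_cons_of_mem hx)),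
      (h a (Multiset.mem_cons_self a s)).neg_one_pow]
    ring

open Classical in
theorem signed (n : ℕ) : ∑ p ∈ (GSet_fin n).toFinset, (-1 : ℤ) ^ Multiset.card p.1 =
    (-1) ^ n * (Hcount n : ℤ) := by
  rw [← Finset.sum_filter_add_sum_filter_not _ (fun p => SS p.1 = ∅)]
  have hz : ∑ p ∈ (GSet_fin n).toFinset with ¬ SS p.1 = ∅, (-1 : ℤ) ^ Multiset.card p.1 = 0 := by
    have key : ∀ p ∈ (GSet_fin n).toFinset.filter (fun p => ¬ SS p.1 = ∅),
        sInf (SS p.1) ∈ SS p.1 := by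
      intro p hp
      exact Nat.sInf_mem (Set.nonempty_iff_ne_empty.2 (Finset.mem_filter.1 hp).2)
    refine Finset.sum_involution (fun p _ => (tog (sInf (SS p.1)) p.1, p.2)) ?_ ?_ ?_ ?_
    · intro p hp
      simp only
      rw [tog_card _ _ (key p hp)]
      ring
    · intro p hp _ h
      have h1 := tog_card _ _ (key p hp)
      have h2 : tog (sInf (SS p.1)) p.1 = p.1 := congrArg Prod.fst h
      rw [h2] at h1
      rcases neg_one_pow_eq_or ℤ (Multiset.card p.1) with h3 | h3 <;> rw [h3] at h1 <;> omega
    · intro p hp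
      have hk := key p hp
      rw [Finset.mem_filter, Set.Finite.mem_toFinset] at hp ⊢
      obtain ⟨⟨h1, h2, h3, h4⟩, h5⟩ := hp
      refine ⟨⟨tog_pos _ _ hk h1, h2, ?_, h4⟩, ?_⟩
      · simp only; rw [tog_sum _ _ hk]; exact h3
      · simp only; rw [tog_SS _ _ hk]; exact h5
    · intro p hp
      have hk := key p hp
      ext1
      · simp only; rw [tog_SS _ _ hk, tog_tog _ _ hk]
      · rfl
  rw [hz, add_zero]
  have hR : ∀ p, p ∈ (GSet_fin n).toFinset.filter (fun p => SS p.1 = ∅) ↔ p ∈ RSet n := by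
    intro p
    rw [Finset.mem_filter, Set.Finite.mem_toFinset]
    exact and_congr_right fun h => SS_empty p.1 h.1
  have hc : (Hcount n : ℤ) = ((GSet_fin n).toFinset.filter (fun p => SS p.1 = ∅)).card := by
    rw [Hcount, ← R_eq_H, ← Set.ncard_coe_finset]
    congr 2
    ext p
    rw [Finset.mem_coe, hR]
  rw [hc, Finset.sum_congr rfl (g := fun _ => (-1 : ℤ) ^ n)]
  · rw [Finset.sum_const, nsmul_eq_mul, mul_comm]
  · intro p hp
    obtain ⟨⟨h1, h2, h3, h4⟩, h5, _⟩ := (hR p).1 hp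
    rw [← h3, pow_add, sgn_even p.2 h4, sgn_sum p.1 h5, mul_one]

/-- `G₂(n) = (G(n) + (-1)^n * H(n)) / 2`. -/
theorem G2_eq (n : ℕ) : (G2 n : ℚ) = ((Gcount n : ℚ) + (-1) ^ n * (Hcount n : ℚ)) / 2 := by
  classical
  have h := signed n
  have hG : Gcount n = (GSet_fin n).toFinset.card := Set.ncard_eq_toFinset_card _ _
  have hG2 : G2 n = ((GSet_fin n).toFinset.filter (fun p => Even (Multiset.card p.1))).card := by
    rw [G2, ← Set.ncard_coe_finset]
    congr 1
    ext p
    simp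
  have h2 : ∑ p ∈ (GSet_fin n).toFinset, (-1 : ℤ) ^ Multiset.card p.1 =
      2 * (G2 n : ℤ) - Gcount n := by
    rw [hG, hG2, Finset.card_filter, Finset.card_eq_sum_ones]
    push_cast
    rw [Finset.mul_sum, ← Finset.sum_sub_distrib]
    refine Finset.sum_congr rfl fun p _ => ?_
    by_cases hp : Even (Multiset.card p.1)
    · simp [hp, hp.neg_one_pow]
    · simp [hp, (Nat.not_even_iff_odd.1 hp).neg_one_pow]
  rw [h2] at h
  have h3 : (2 * (G2 n : ℚ) - Gcount n) = (-1) ^ n * (Hcount n : ℚ) := by exact_mod_cast h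
  linarith
end
end

section
/- For every nonnegative integer n, G_4(n) = (G(n) + (-1)^n · K(n))/2, where G_4(n) counts the partitions counted by G(n) having an even total number of parts. -/
noncomputable section

section helpers
open Finset PowerSeries PowerSeries.WithPiTopology Nat.Partition

def PF (k : ℕ) : Finset (Multiset ℕ) := (univ : Finset k.Partition).image Nat.Partition.parts

lemma mem_PF {k : ℕ} {m : Multiset ℕ} : m ∈ PF k ↔ (∀ x ∈ m, 0 < x) ∧ m.sum = k := by
  simp only [PF, mem_image, mem_univ, true_and]
  constructor
  · rintro ⟨p, rfl⟩
    exact ⟨fun x hx => p.parts_pos hx, p.parts_sum⟩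
  · rintro ⟨h1, h2⟩
    exact ⟨⟨m, fun {i} hi => h1 i hi, h2⟩, rfl⟩

def DF (k : ℕ) : Finset (Multiset ℕ) := (PF k).filter (fun m => m.Nodup ∧ ∀ x ∈ m, ¬ 2 ∣ x)

def gA : ℤ⟦X⟧ := genFun (fun _ c => (-1 : ℤ) ^ c)
def gB : ℤ⟦X⟧ := genFun (fun i c => if ¬ 2 ∣ i ∧ c = 1 then (-1 : ℤ) else 0)

lemma gA_eq_gB : gA = gB := by
  let _ : TopologicalSpace ℤ := ⊥
  have _ : DiscreteTopology ℤ := ⟨rfl⟩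
  have h := powerSeriesMk_card_restricted_eq_powerSeriesMk_card_countRestricted ℤ
    (m := 2) (by norm_num)
  have hO := hasProd_powerSeriesMk_card_restricted ℤ (¬ 2 ∣ ·)
  have hD := hasProd_powerSeriesMk_card_countRestricted ℤ (m := 2) (by norm_num)
  rw [← h] at hD
  set E : ℤ⟦X⟧ := PowerSeries.mk fun n ↦ (#(restricted n (¬ 2 ∣ ·)) : ℤ)
  have hA : HasProd _ gA := hasProd_genFun (fun _ c => (-1 : ℤ) ^ c)
  have hB : HasProd _ gB := hasProd_genFun (fun i c => if ¬ 2 ∣ i ∧ c = 1 then (-1 : ℤ) else 0)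
  have h1 : gA * E = 1 := by
    refine (hA.mul hD).unique ?_
    convert! (hasProd_one : HasProd (fun _ : ℕ => (1 : ℤ⟦X⟧)) 1) using 1
    ext1 i
    have hc : constantCoeff (-(X : ℤ⟦X⟧) ^ (i + 1)) = 0 := by simp
    have key := tsum_pow_mul_one_sub_of_constantCoeff_eq_zero hc
    have hs := summable_pow_of_constantCoeff_eq_zero hc
    rw [hs.tsum_eq_zero_add] at key
    rw [← key]
    congr 1
    · rw [pow_zero]
      congr 1
      refine tsum_congr fun j => ?_
      rw [neg_pow ((X : ℤ⟦X⟧) ^ (i+1)), ← pow_mul, PowerSeries.smul_eq_C_mul]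
      simp
    · simp [Finset.sum_range_succ]
  have h2 : gB * E = 1 := by
    refine (hB.mul hO).unique ?_
    convert! (hasProd_one : HasProd (fun _ : ℕ => (1 : ℤ⟦X⟧)) 1) using 1
    ext1 i
    by_cases hi : 2 ∣ i + 1
    · simp [hi, PowerSeries.smul_eq_C_mul]
    · have hc : constantCoeff ((X : ℤ⟦X⟧) ^ (i + 1)) = 0 := by simp
      have key := one_sub_mul_tsum_pow_of_constantCoeff_eq_zero hc
      rw [tsum_eq_single 0 (by intro j hj; simp [hj, PowerSeries.smul_eq_C_mul])]
      simp only [hi, if_true, not_false_eq_true, pow_mul]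
      refine Eq.trans ?_ key
      congr 1
      simp [sub_eq_add_neg, PowerSeries.smul_eq_C_mul]
  calc gA = gA * (gB * E) := by rw [h2, mul_one]
    _ = gB * (gA * E) := by ring
    _ = gB := by rw [h1, mul_one]

lemma core (k : ℕ) : ∑ m ∈ PF k, (-1 : ℤ) ^ (Multiset.card m) =
    ∑ m ∈ DF k, (-1 : ℤ) ^ (Multiset.card m) := by
  have hinj : Set.InjOn (Nat.Partition.parts (n := k)) (univ : Finset k.Partition) :=
    fun a _ b _ h => Nat.Partition.ext h
  have h := congrArg (PowerSeries.coeff k) gA_eq_gB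
  rw [gA, gB, coeff_genFun, coeff_genFun] at h
  rw [DF, sum_filter, PF, sum_image hinj, sum_image hinj]
  convert h using 1
  · refine sum_congr rfl fun p _ => ?_
    rw [Finsupp.prod, prod_pow_eq_pow_sum]
    congr 1
    simp
  · refine sum_congr rfl fun p _ => ?_
    rw [Finsupp.prod]
    simp only [Multiset.toFinsupp_support, Multiset.toFinsupp_apply]
    split_ifs with hp
    · rw [prod_congr rfl (g := fun _ => (-1 : ℤ)), prod_const,
        Multiset.toFinset_card_of_nodup hp.1]
      intro x hx
      rw [Multiset.mem_toFinset] at hx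
      exact if_pos ⟨hp.2 x hx, Multiset.count_eq_one_of_mem hp.1 hx⟩
    · by_contra hne
      apply hp
      have hall : ∀ x ∈ p.parts, ¬ 2 ∣ x ∧ p.parts.count x = 1 := by
        intro x hx
        by_contra hx'
        exact hne (prod_eq_zero (Multiset.mem_toFinset.2 hx) (if_neg hx')).symm
      refine ⟨Multiset.nodup_iff_count_le_one.2 fun x => ?_, fun x hx => (hall x hx).1⟩
      by_cases hx : x ∈ p.parts
      · exact (hall x hx).2.le
      · simp [Multiset.count_eq_zero_of_notMem hx]

def TT (n : ℕ) : Finset (ℕ × ℕ) :=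
  (range (n + 1) ×ˢ range (n + 1)).filter (fun q => q.1 + 2 * q.2 = n)

lemma mem_TT {n : ℕ} {q : ℕ × ℕ} : q ∈ TT n ↔ q.1 + 2 * q.2 = n := by
  simp only [TT, mem_filter, mem_product, mem_range]; omega

def dbl (m : Multiset ℕ) : Multiset ℕ := m.map (2 * ·)
def hlf (m : Multiset ℕ) : Multiset ℕ := m.map (· / 2)

lemma hlf_dbl (m : Multiset ℕ) : hlf (dbl m) = m := by
  simp [hlf, dbl]

lemma dbl_hlf (m : Multiset ℕ) (h : ∀ x ∈ m, Even x) : dbl (hlf m) = m := by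
  rw [hlf, dbl, Multiset.map_map]
  conv_rhs => rw [← Multiset.map_id m]
  refine Multiset.map_congr rfl fun x hx => ?_
  have := h x hx
  simp only [Function.comp, id]
  grind

lemma dbl_sum (m : Multiset ℕ) : (dbl m).sum = 2 * m.sum := by
  rw [dbl, Multiset.sum_map_mul_left]; simp

lemma dbl_card (m : Multiset ℕ) : Multiset.card (dbl m) = Multiset.card m := by simp [dbl]

def GP (n : ℕ) : Finset (Σ _ : ℕ × ℕ, Multiset ℕ × Multiset ℕ) :=
  (TT n).sigma (fun q => PF q.1 ×ˢ PF q.2)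
def KP (n : ℕ) : Finset (Σ _ : ℕ × ℕ, Multiset ℕ × Multiset ℕ) :=
  (TT n).sigma (fun q => DF q.1 ×ˢ DF q.2)

def gm (t : Σ _ : ℕ × ℕ, Multiset ℕ × Multiset ℕ) : Multiset ℕ × Multiset ℕ := (t.2.1, dbl t.2.2)
def km (t : Σ _ : ℕ × ℕ, Multiset ℕ × Multiset ℕ) : Finset ℕ := (t.2.1 + dbl t.2.2).toFinset

lemma GK (n : ℕ) : ∑ t ∈ GP n, (-1 : ℤ) ^ (Multiset.card (t.2.1 + t.2.2)) =
    ∑ t ∈ KP n, (-1 : ℤ) ^ (Multiset.card (t.2.1 + t.2.2)) := by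
  rw [GP, KP, sum_sigma, sum_sigma]
  refine sum_congr rfl fun q _ => ?_
  simp only [Multiset.card_add, pow_add]
  rw [sum_product, sum_product]
  simp only [← mul_sum, ← sum_mul, core]

lemma gm_inj (n : ℕ) : Set.InjOn gm (GP n) := by
  rintro ⟨⟨a, b⟩, x, y⟩ h ⟨⟨a', b'⟩, x', y'⟩ h' e
  simp only [GP, coe_sigma, Set.mem_sigma_iff, mem_coe, mem_product, mem_PF, gm,
    Prod.mk.injEq] at h h' e
  obtain ⟨rfl, e⟩ := e
  have e := congrArg hlf e
  rw [hlf_dbl, hlf_dbl] at e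
  subst e
  obtain ⟨-, ⟨-, rfl⟩, -, rfl⟩ := h
  obtain ⟨-, ⟨-, rfl⟩, -, rfl⟩ := h'
  rfl

lemma mem_GI (n : ℕ) (p) : p ∈ (GP n).image gm ↔ p ∈ GSet n := by
  obtain ⟨u, v⟩ := p
  simp only [mem_image, GSet, Set.mem_setOf_eq, GP, mem_sigma, mem_product, mem_PF, mem_TT]
  constructor
  · rintro ⟨⟨⟨a, b⟩, x, y⟩, ⟨h0, ⟨h1, h2⟩, h3, h4⟩, e⟩
    simp only [gm, Prod.mk.injEq] at e h0 h1 h2 h3 h4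
    obtain ⟨rfl, rfl⟩ := e
    refine ⟨h1, ?_, ?_, ?_⟩
    · simpa [dbl] using h3
    · rw [dbl_sum]; omega
    · simp [dbl]
  · rintro ⟨h1, h2, h3, h4⟩
    have e := dbl_hlf v h4
    have es := dbl_sum (hlf v)
    rw [e] at es
    refine ⟨⟨(u.sum, (hlf v).sum), u, hlf v⟩, ⟨?_, ⟨h1, rfl⟩, ?_, rfl⟩, ?_⟩
    · simp only; omega
    · simp only [hlf, Multiset.mem_map]
      rintro _ ⟨x, hx, rfl⟩
      have := h2 x hx
      have := h4 x hx
      grind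
    · simp [gm, e]

lemma km_val {n : ℕ} {t} (h : t ∈ KP n) : (km t).val = t.2.1 + dbl t.2.2 := by
  obtain ⟨⟨a, b⟩, x, y⟩ := t
  simp only [KP, mem_sigma, mem_product, DF, mem_filter] at h
  rw [km, Multiset.toFinset_val, Multiset.dedup_eq_self]
  simp only
  rw [Multiset.nodup_add]
  refine ⟨h.2.1.2.1, h.2.2.2.1.map (fun a b h => by simpa using h), ?_⟩
  rw [Multiset.disjoint_left]
  intro z hz hz'
  simp only [dbl, Multiset.mem_map] at hz'
  obtain ⟨w, -, rfl⟩ := hz'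
  exact h.2.1.2.2 _ hz ⟨w, rfl⟩

lemma filt {n : ℕ} {t} (h : t ∈ KP n) : (km t).val.filter (fun x => ¬ Even x) = t.2.1 ∧
    (km t).val.filter (fun x => Even x) = dbl t.2.2 := by
  rw [km_val h]
  obtain ⟨⟨a, b⟩, x, y⟩ := t
  simp only [KP, mem_sigma, mem_product, DF, mem_filter] at h
  have hx : ∀ z ∈ x, ¬ Even z := fun z hz => by
    rw [even_iff_two_dvd]; exact h.2.1.2.2 z hz
  have hy : ∀ z ∈ dbl y, Even z := fun z hz => by
    simp only [dbl, Multiset.mem_map] at hz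
    obtain ⟨w, -, rfl⟩ := hz
    simp
  simp only [Multiset.filter_add]
  rw [Multiset.filter_eq_self.2 hx, Multiset.filter_eq_nil.2 (fun z hz => not_not.2 (hy z hz)),
    Multiset.filter_eq_self.2 hy, Multiset.filter_eq_nil.2 hx]
  simp

lemma km_inj (n : ℕ) : Set.InjOn km (KP n) := by
  intro t h t' h' e
  have f := filt (mem_coe.1 h)
  have f' := filt (mem_coe.1 h')
  rw [e] at f
  have e1 := f.1.symm.trans f'.1
  have e2 := congrArg hlf (f.2.symm.trans f'.2)
  rw [hlf_dbl, hlf_dbl] at e2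
  obtain ⟨⟨a, b⟩, x, y⟩ := t
  obtain ⟨⟨a', b'⟩, x', y'⟩ := t'
  simp only at e1 e2
  subst e1 e2
  simp only [KP, mem_coe, mem_sigma, mem_product, DF, mem_filter, mem_PF] at h h'
  obtain ⟨-, ⟨⟨-, rfl⟩, -⟩, ⟨-, rfl⟩, -⟩ := h
  obtain ⟨-, ⟨⟨-, rfl⟩, -⟩, ⟨-, rfl⟩, -⟩ := h'
  rfl

lemma mem_KI (n : ℕ) (s) : s ∈ (KP n).image km ↔ s ∈ KSet n := by
  rw [mem_image]
  constructor
  · rintro ⟨t, h, rfl⟩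
    have hv := km_val h
    obtain ⟨⟨a, b⟩, x, y⟩ := t
    simp only [KP, mem_sigma, mem_product, DF, mem_filter, mem_PF, mem_TT] at h
    obtain ⟨h0, ⟨⟨h1, h2⟩, h3, h4⟩, ⟨h5, h6⟩, h7, h8⟩ := h
    have hm : ∀ z, z ∈ km ⟨(a, b), x, y⟩ ↔ z ∈ x ∨ ∃ w ∈ y, 2 * w = z := by
      intro z; simp [km, dbl]
    refine ⟨?_, ?_, ?_⟩
    · intro z hz
      rcases (hm z).1 hz with hz | ⟨w, hw, rfl⟩
      · exact h1 z hz
      · have := h5 w hw; omega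
    · rw [Finset.sum_eq_multiset_sum, Multiset.map_id, hv, Multiset.sum_add, dbl_sum]
      simp only; omega
    · intro z hz he
      rcases (hm z).1 hz with hz | ⟨w, hw, rfl⟩
      · exact absurd (even_iff_two_dvd.1 he) (h4 z hz)
      · have := h8 w hw; omega
  · rintro ⟨h1, h2, h3⟩
    set u := s.val.filter (fun x => ¬ Even x) with hu
    set v := s.val.filter (fun x => Even x) with hv
    have e : dbl (hlf v) = v := dbl_hlf v (fun x hx => (Multiset.mem_filter.1 hx).2)
    have es := dbl_sum (hlf v)
    rw [e] at es
    have huv : u + v = s.val := by rw [add_comm]; exact Multiset.filter_add_not _ _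
    have hsum : u.sum + v.sum = n := by
      rw [← Multiset.sum_add, huv, ← h2, Finset.sum_eq_multiset_sum, Multiset.map_id]
    have hw : ∀ w ∈ hlf v, 2 * w ∈ s := by
      intro w hw
      have : 2 * w ∈ dbl (hlf v) := Multiset.mem_map_of_mem _ hw
      rw [e] at this
      exact (Multiset.mem_filter.1 this).1
    refine ⟨⟨(u.sum, (hlf v).sum), u, hlf v⟩, ?_, ?_⟩
    · simp only [KP, mem_sigma, mem_product, DF, mem_filter, mem_PF, mem_TT]
      refine ⟨by omega, ⟨⟨?_, trivial⟩, s.nodup.filter _, ?_⟩, ⟨?_, trivial⟩, ?_, ?_⟩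
      · exact fun x hx => h1 x (Multiset.mem_filter.1 hx).1
      · intro x hx
        rw [← even_iff_two_dvd]; exact (Multiset.mem_filter.1 hx).2
      · intro w hw'
        have := h1 _ (hw w hw'); omega
      · apply Multiset.Nodup.of_map (2 * ·)
        change (dbl (hlf v)).Nodup
        rw [e]; exact s.nodup.filter _
      · intro w hw'
        have := h3 _ (hw w hw') (by simp); omega
    · rw [km]; simp only
      rw [e, huv]; exact s.val_toFinset

lemma sgn_odd {ι : Type*} (s : Finset ι) (f : ι → ℕ) :
    ∑ p ∈ s, (-1 : ℤ) ^ f p = (#(s.filter (fun p => Even (f p))) : ℤ)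
      - #(s.filter (fun p => Odd (f p))) := by
  rw [card_filter, card_filter]
  push_cast
  rw [← sum_sub_distrib]
  refine sum_congr rfl fun p _ => ?_
  rcases Nat.even_or_odd (f p) with h | h
  · simp [h, Nat.not_odd_iff_even.2 h]
  · simp [h, Nat.not_even_iff_odd.2 h]

lemma sgn_all {ι : Type*} (s : Finset ι) (f : ι → ℕ) :
    ∑ p ∈ s, (-1 : ℤ) ^ f p = 2 * (#(s.filter (fun p => Even (f p))) : ℤ) - #s := by
  rw [sgn_odd]
  have := card_filter_add_card_filter_not (s := s) (fun p => Even (f p))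
  simp only [Nat.not_even_iff_odd] at this
  omega

lemma parity_sum (m : Multiset ℕ) :
    (-1 : ℤ) ^ m.sum = (-1) ^ Multiset.card (m.filter (fun x => ¬ Even x)) := by
  induction m using Multiset.induction_on with
  | empty => simp
  | cons a m ih =>
    rw [Multiset.sum_cons, pow_add, ih]
    by_cases h : Even a
    · simp [h]
    · rw [Multiset.filter_cons_of_pos (p := fun x => ¬ Even x) _ h, (Nat.not_even_iff_odd.1 h).neg_one_pow,
        Multiset.card_cons, pow_succ]
      ring

lemma Ksum (n : ℕ) : (-1 : ℤ) ^ n * Kcount n =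
    ∑ t ∈ KP n, (-1 : ℤ) ^ (Multiset.card (t.2.1 + t.2.2)) := by
  have hc : ∀ P : Finset ℕ → Prop, ∀ _ : DecidablePred P,
      {s ∈ KSet n | P s}.ncard = #(((KP n).image km).filter P) := by
    intro P _
    rw [← Set.ncard_coe_finset]
    congr 1
    ext s
    rw [mem_coe, mem_filter, mem_KI]; rfl
  rw [Kcount, hc _ inferInstance, hc _ inferInstance, ← sgn_odd, sum_image (km_inj n), mul_sum]
  refine sum_congr rfl fun t ht => ?_
  have hf := filt ht
  have hk : km t ∈ KSet n := (mem_KI n _).1 (mem_image_of_mem _ ht)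
  have hn : (km t).val.sum = n := by
    rw [← hk.2.1, Finset.sum_eq_multiset_sum, Multiset.map_id]
  have hp := parity_sum (km t).val
  rw [hn, hf.1] at hp
  rw [hp, Multiset.card_add, pow_add]
  congr 2
  rw [← dbl_card, ← hf.2]; rfl

lemma Gsum (n : ℕ) : 2 * (G4 n : ℤ) - Gcount n =
    ∑ t ∈ GP n, (-1 : ℤ) ^ (Multiset.card (t.2.1 + t.2.2)) := by
  have h1 : Gcount n = #((GP n).image gm) := by
    rw [Gcount, ← Set.ncard_coe_finset]
    congr 1
    ext s
    rw [mem_coe, mem_GI]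
  have h2 : G4 n = #(((GP n).image gm).filter (fun p => Even (Multiset.card (p.1 + p.2)))) := by
    rw [G4, ← Set.ncard_coe_finset]
    congr 1
    ext s
    rw [mem_coe, mem_filter, mem_GI]; rfl
  rw [h1, h2, ← sgn_all, sum_image (gm_inj n)]
  refine sum_congr rfl fun t ht => ?_
  simp [gm, dbl_card]

end helpers

/-- `G₄(n) = (G(n) + (-1)^n * K(n)) / 2`. -/
theorem G4_eq (n : ℕ) : (G4 n : ℚ) = ((Gcount n : ℚ) + (-1) ^ n * (Kcount n : ℚ)) / 2 := by
  have h := (Gsum n).trans ((GK n).trans (Ksum n).symm)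
  have h' : 2 * (G4 n : ℚ) - Gcount n = (-1) ^ n * (Kcount n : ℚ) := by exact_mod_cast h
  linarith
end
end

section
/- For every nonnegative integer n, G_5(n) = (G(n) - (-1)^n · K(n))/2, where G_5(n) counts the partitions counted by G(n) having an odd total number of parts. -/
noncomputable section

section Aux
open PowerSeries PowerSeries.WithPiTopology Finset Nat.Partition

def auxD (e : ℤ) (p : ℕ → Prop) [DecidablePred p] : ℕ → ℕ → ℤ :=
  fun i j => if p i ∧ j = 1 then e else 0

def auxP (p : ℕ → Prop) [DecidablePred p] : ℕ → ℕ → ℤ :=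
  fun i j => if p i then (-1) ^ j else 0

theorem hasProd_auxD (e : ℤ) (p : ℕ → Prop) [DecidablePred p] :
    HasProd (fun i => if p (i + 1) then (1 : ℤ⟦X⟧) + C e * X ^ (i + 1) else 1)
      (genFun (auxD e p)) := by
  convert! hasProd_genFun (auxD e p) using 1
  ext1 i
  simp_rw [PowerSeries.smul_eq_C_mul]
  rw [tsum_eq_single 0]
  · by_cases h : p (i + 1) <;> simp [auxD, h]
  · intro b hb
    simp [auxD, hb]

theorem auxP_mul_auxD (p : ℕ → Prop) [DecidablePred p] :
    genFun (auxP p) * genFun (auxD 1 p) = 1 := by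
  have h := (hasProd_genFun (auxP p)).mul (hasProd_auxD 1 p)
  refine h.unique ?_
  convert! (hasProd_one : HasProd (fun _ : ℕ => (1 : ℤ⟦X⟧)) 1) using 1
  ext1 i
  simp_rw [PowerSeries.smul_eq_C_mul]
  by_cases hp : p (i + 1)
  · have h0 : constantCoeff (-(X : ℤ⟦X⟧) ^ (i + 1)) = 0 := by simp
    have h1 := tsum_pow_mul_one_sub_of_constantCoeff_eq_zero h0
    have hs : Summable (fun j => (-(X : ℤ⟦X⟧) ^ (i + 1)) ^ j) :=
      summable_pow_of_constantCoeff_eq_zero h0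
    rw [hs.tsum_eq_zero_add] at h1
    simp only [hp, auxP, if_true]
    have h2 : ∀ j : ℕ, C ((-1 : ℤ) ^ (j + 1)) * (X : ℤ⟦X⟧) ^ ((i + 1) * (j + 1))
        = (-(X : ℤ⟦X⟧) ^ (i + 1)) ^ (j + 1) := by
      intro j
      rw [neg_pow (X ^ (i + 1) : ℤ⟦X⟧), ← pow_mul]
      simp
    simp_rw [h2]
    simpa using h1
  · simp [hp, auxP]

theorem auxD_double (m : ℕ) :
    genFun (auxD (-1) (m ∣ ·)) * genFun (auxD 1 (m ∣ ·)) = genFun (auxD (-1) (2 * m ∣ ·)) := by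
  have h := (hasProd_auxD (-1) (m ∣ ·)).mul (hasProd_auxD 1 (m ∣ ·))
  refine h.unique ?_
  have h2 := hasProd_auxD (-1) (2 * m ∣ ·)
  have hinj : Function.Injective (fun i : ℕ => 2 * i + 1) := by
    intro a b hab
    simp only at hab
    omega
  rw [← hinj.hasProd_iff] at h2
  · convert h2 using 1
    ext1 i
    have : (2 * m ∣ 2 * i + 1 + 1) ↔ m ∣ i + 1 := by
      rw [show 2 * i + 1 + 1 = 2 * (i + 1) by ring]
      exact Nat.mul_dvd_mul_iff_left (by norm_num)
    by_cases hm : m ∣ i + 1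
    · simp [this, hm]
      ring
    · simp [this, hm]
  · intro x hx
    rw [if_neg]
    intro hd
    apply hx
    have : 2 ∣ x + 1 := (Dvd.intro m rfl).trans hd
    exact ⟨x / 2, by simp only; omega⟩

theorem auxD_split :
    genFun (auxD (-1) (¬ 4 ∣ ·)) * genFun (auxD (-1) (4 ∣ ·)) = genFun (auxD (-1) (1 ∣ ·)) := by
  have h := (hasProd_auxD (-1) (¬ 4 ∣ ·)).mul (hasProd_auxD (-1) (4 ∣ ·))
  refine h.unique ?_
  convert hasProd_auxD (-1) (1 ∣ ·) using 1
  ext1 i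
  by_cases hm : 4 ∣ i + 1 <;> simp [hm]

theorem aux_main :
    genFun (auxP (1 ∣ ·)) * genFun (auxP (2 ∣ ·)) = genFun (auxD (-1) (¬ 4 ∣ ·)) := by
  have e1 := auxD_double 1
  have e2 := auxD_double 2
  have e3 := auxD_split
  have p1 := auxP_mul_auxD (1 ∣ ·)
  have p2 := auxP_mul_auxD (2 ∣ ·)
  have h0 : genFun (auxD (-1) (4 ∣ ·)) ≠ 0 := by
    intro h
    have := congrArg (coeff 0) h
    simp at this
  apply mul_right_cancel₀ h0
  rw [e3, ← e2, ← e1]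
  linear_combination (genFun (auxD (-1) (1 ∣ ·))) * (genFun (auxP (2 ∣ ·)) * genFun (auxD 1 (2 ∣ ·)) * p1 + p2)

def PP (n : ℕ) : Finset (Multiset ℕ) := univ.image (fun p : n.Partition => p.parts)

theorem mem_PP {n : ℕ} {m : Multiset ℕ} : m ∈ PP n ↔ (∀ x ∈ m, 0 < x) ∧ m.sum = n := by
  simp only [PP, mem_image, mem_univ, true_and]
  constructor
  · rintro ⟨p, rfl⟩
    exact ⟨fun x hx => p.parts_pos hx, p.parts_sum⟩
  · rintro ⟨h1, h2⟩
    exact ⟨⟨m, fun {x} hx => h1 x hx, h2⟩, rfl⟩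

theorem coeff_PP (f : ℕ → ℕ → ℤ) (n : ℕ) :
    coeff n (genFun f) = ∑ m ∈ PP n, m.toFinsupp.prod f := by
  rw [coeff_genFun, PP, sum_image]
  intro p _ q _ h
  exact Nat.Partition.ext h

theorem signed_s13 {α : Type*} (T : Finset α) (c : α → ℕ) :
    ({x ∈ (T : Set α) | Even (c x)}.ncard : ℤ) - ({x ∈ (T : Set α) | Odd (c x)}.ncard : ℤ)
      = ∑ x ∈ T, (-1) ^ c x := by
  classical
  have h1 : {x ∈ (T : Set α) | Even (c x)} = ((T.filter fun x => Even (c x) : Finset α) : Set α) := by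
    ext; simp
  have h2 : {x ∈ (T : Set α) | Odd (c x)} = ((T.filter fun x => Odd (c x) : Finset α) : Set α) := by
    ext; simp
  rw [h1, h2, Set.ncard_coe_finset, Set.ncard_coe_finset, card_filter, card_filter]
  push_cast
  rw [← sum_sub_distrib]
  refine sum_congr rfl fun x _ => ?_
  rcases Nat.even_or_odd (c x) with h | h
  · simp [h, Nat.not_odd_iff_even.2 h]
  · simp [h, Nat.not_even_iff_odd.2 h]

theorem total {α : Type*} (T : Finset α) (c : α → ℕ) :
    {x ∈ (T : Set α) | Even (c x)}.ncard + {x ∈ (T : Set α) | Odd (c x)}.ncard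
      = (T : Set α).ncard := by
  classical
  have h1 : {x ∈ (T : Set α) | Even (c x)} = ((T.filter fun x => Even (c x) : Finset α) : Set α) := by
    ext; simp
  have h2 : {x ∈ (T : Set α) | Odd (c x)} = ((T.filter fun x => ¬ Even (c x) : Finset α) : Set α) := by
    ext; simp
  rw [h1, h2, Set.ncard_coe_finset, Set.ncard_coe_finset, Set.ncard_coe_finset]
  exact card_filter_add_card_filter_not _

theorem prod_auxP (p : ℕ → Prop) [DecidablePred p] (m : Multiset ℕ) :
    m.toFinsupp.prod (auxP p) = if ∀ x ∈ m, p x then (-1) ^ m.card else 0 := by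
  rw [Finsupp.prod, Multiset.toFinsupp_support]
  simp only [Multiset.toFinsupp_apply, auxP]
  split_ifs with h
  · rw [← Multiset.toFinset_sum_count_eq m, ← prod_pow_eq_pow_sum]
    refine prod_congr rfl fun x hx => ?_
    rw [if_pos (h x (Multiset.mem_toFinset.1 hx))]
  · push Not at h
    obtain ⟨x, hx, hp⟩ := h
    exact prod_eq_zero (Multiset.mem_toFinset.2 hx) (if_neg hp)

theorem prod_auxD (p : ℕ → Prop) [DecidablePred p] (m : Multiset ℕ) :
    m.toFinsupp.prod (auxD (-1) p) = if (∀ x ∈ m, p x) ∧ m.Nodup then (-1) ^ m.card else 0 := by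
  rw [Finsupp.prod, Multiset.toFinsupp_support]
  simp only [Multiset.toFinsupp_apply, auxD]
  split_ifs with h
  · rw [← Multiset.toFinset_card_of_nodup h.2, ← prod_const]
    refine prod_congr rfl fun x hx => ?_
    have hx' := Multiset.mem_toFinset.1 hx
    exact if_pos ⟨h.1 x hx', Multiset.count_eq_one_of_mem h.2 hx'⟩
  · by_cases h1 : ∀ x ∈ m, p x
    · have h2 : ¬ m.Nodup := fun h2 => h ⟨h1, h2⟩
      rw [Multiset.nodup_iff_count_eq_one] at h2
      push Not at h2
      obtain ⟨x, hx, hp⟩ := h2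
      exact prod_eq_zero (Multiset.mem_toFinset.2 hx) (if_neg fun h => hp h.2)
    · push Not at h1
      obtain ⟨x, hx, hp⟩ := h1
      exact prod_eq_zero (Multiset.mem_toFinset.2 hx) (if_neg fun h => hp h.1)

def GF (n : ℕ) : Finset (Multiset ℕ × Multiset ℕ) :=
  (antidiagonal n).biUnion fun ab => PP ab.1 ×ˢ (PP ab.2).filter (fun m => ∀ x ∈ m, 2 ∣ x)

theorem coe_GF (n : ℕ) : (GF n : Set _) = GSet n := by
  ext ⟨a, b⟩
  simp only [GF, GSet, mem_coe, mem_biUnion, HasAntidiagonal.mem_antidiagonal, mem_product, mem_filter, mem_PP,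
    Set.mem_ofPred_eq, Prod.exists, even_iff_two_dvd]
  constructor
  · rintro ⟨i, j, h, ⟨h1, rfl⟩, ⟨h2, rfl⟩, h3⟩
    exact ⟨h1, h2, h, h3⟩
  · rintro ⟨h1, h2, h, h3⟩
    exact ⟨_, _, h, ⟨h1, rfl⟩, ⟨h2, rfl⟩, h3⟩

theorem sum_GF (n : ℕ) : ∑ p ∈ GF n, (-1 : ℤ) ^ (Multiset.card (p.1 + p.2)) =
    coeff n (genFun (auxP (1 ∣ ·)) * genFun (auxP (2 ∣ ·))) := by
  rw [coeff_mul, GF, sum_biUnion]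
  · refine sum_congr rfl fun ab _ => ?_
    rw [coeff_PP, coeff_PP, sum_mul_sum, sum_product]
    refine sum_congr rfl fun a _ => ?_
    rw [sum_filter]
    refine sum_congr rfl fun b _ => ?_
    rw [prod_auxP, prod_auxP]
    simp [pow_add]
  · intro i _ j _ hij
    simp only [Function.onFun]
    rw [disjoint_left]
    rintro ⟨a, b⟩ h1 h2
    simp only [mem_product, mem_filter, mem_PP] at h1 h2
    apply hij
    ext
    · exact h1.1.2.symm.trans h2.1.2
    · exact h1.2.1.2.symm.trans h2.2.1.2

def KF (n : ℕ) : Finset (Finset ℕ) :=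
  (range (n + 1)).powerset.filter fun s =>
    (∀ x ∈ s, 0 < x) ∧ s.sum id = n ∧ ∀ x ∈ s, Even x → x % 4 = 2

theorem coe_KF (n : ℕ) : (KF n : Set _) = KSet n := by
  ext s
  simp only [KF, KSet, coe_filter, mem_powerset, Set.mem_ofPred_eq, and_iff_right_iff_imp]
  rintro ⟨h1, h2, h3⟩ x hx
  have := single_le_sum (f := id) (fun i _ => Nat.zero_le _) hx
  simp only [id, mem_range] at *
  omega

theorem sum_KF (n : ℕ) : (-1) ^ n * ∑ s ∈ KF n, (-1 : ℤ) ^ (s.filter (fun x => Even x)).card =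
    coeff n (genFun (auxD (-1) (¬ 4 ∣ ·))) := by
  rw [coeff_PP, mul_sum]
  simp_rw [prod_auxD]
  rw [← sum_filter]
  refine sum_bij (fun s _ => s.val) ?_ ?_ ?_ ?_
  · intro s hs
    simp only [KF, mem_filter, mem_PP] at hs ⊢
    obtain ⟨-, h1, h2, h3⟩ := hs
    refine ⟨⟨h1, ?_⟩, ?_, s.nodup⟩
    · exact (Finset.sum_val s).trans h2
    · intro x hx h4
      have := h3 x hx (by rw [Nat.even_iff]; omega)
      omega
  · intro a _ b _ h
    exact Finset.val_injective h
  · intro m hm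
    simp only [mem_filter, mem_PP] at hm
    obtain ⟨⟨h1, h2⟩, h3, h4⟩ := hm
    refine ⟨⟨m, h4⟩, ?_, rfl⟩
    rw [← mem_coe, coe_KF]
    refine ⟨h1, (Finset.sum_val _).symm.trans h2, fun x hx he => ?_⟩
    have := h3 x hx
    rw [Nat.even_iff] at he
    omega
  · intro s hs
    simp only [KF, mem_filter] at hs
    rw [← hs.2.2.1, ← prod_pow_eq_pow_sum, ← prod_const, prod_filter, ← prod_mul_distrib]
    rw [show Multiset.card s.val = s.card from rfl, ← prod_const]
    refine prod_congr rfl fun x _ => ?_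
    rcases Nat.even_or_odd x with h | h
    · simp [h]
    · simp [h, Nat.not_even_iff_odd.2 h]

end Aux

/-- `G₅(n) = (G(n) - (-1)^n * K(n)) / 2`. -/
theorem G5_eq (n : ℕ) : (G5 n : ℚ) = ((Gcount n : ℚ) - (-1) ^ n * (Kcount n : ℚ)) / 2 := by

  have hG := total (GF n) (fun p => Multiset.card (p.1 + p.2))
  have hS := signed_s13 (GF n) (fun p => Multiset.card (p.1 + p.2))
  have hK := signed_s13 (KF n) (fun s => (s.filter (fun x => Even x)).card)
  rw [sum_GF, aux_main, ← sum_KF, ← hK] at hS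
  rw [coe_GF] at hG hS
  rw [coe_KF] at hS
  change G4 n + G5 n = Gcount n at hG
  change (G4 n : ℤ) - (G5 n : ℤ) = (-1) ^ n * Kcount n at hS
  have hG' : (G4 n : ℚ) + G5 n = Gcount n := by exact_mod_cast hG
  have hS' : (G4 n : ℚ) - (G5 n : ℚ) = (-1) ^ n * (Kcount n : ℚ) := by exact_mod_cast hS
  linarith
end
end

section
/- For every nonnegative integer n, G_2(n) - G_3(n) = (-1)^n · H(n), where G_2(n) (resp. G_3(n)) counts the partitions counted by G(n) with an even (resp. odd) number of blue parts, and H(n) is the number of partitions of n in which the odd parts are distinct. -/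
noncomputable section

namespace G23

/-- `x` is a toggle position for `b`. -/
def P (b : Multiset ℕ) (x : ℕ) : Prop := Odd (b.count (2 * x)) ∨ 2 ≤ b.count x

open Classical in
/-- Split one `2x` into `x, x`, or merge. -/
def tog (b : Multiset ℕ) (x : ℕ) : Multiset ℕ :=
  if Odd (b.count (2 * x)) then x ::ₘ x ::ₘ b.erase (2 * x)
  else (2 * x) ::ₘ (b.erase x).erase x

lemma tog_count_odd {b : Multiset ℕ} {x : ℕ} (hx : 0 < x) (h : Odd (b.count (2 * x))) (y : ℕ) :
    (tog b x).count y = if y = x then b.count y + 2 else if y = 2 * x then b.count y - 1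
      else b.count y := by
  unfold tog
  rw [if_pos h]
  by_cases h1 : y = x
  · subst h1
    have : y ≠ 2 * y := by omega
    simp [Multiset.count_erase_of_ne this]
  · by_cases h2 : y = 2 * x
    · subst h2
      simp [Multiset.count_cons, h1]
    · simp [Multiset.count_cons, h1, h2, Multiset.count_erase_of_ne h2]

lemma tog_count_even {b : Multiset ℕ} {x : ℕ} (hx : 0 < x) (h : ¬ Odd (b.count (2 * x))) (y : ℕ) :
    (tog b x).count y = if y = x then b.count y - 2 else if y = 2 * x then b.count y + 1
      else b.count y := by
  unfold tog
  rw [if_neg h]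
  by_cases h1 : y = x
  · subst h1
    have : y ≠ 2 * y := by omega
    simp [Multiset.count_cons, this]
    omega
  · by_cases h2 : y = 2 * x
    · subst h2
      simp [Multiset.count_cons, h1, Multiset.count_erase_of_ne h1]
    · simp [Multiset.count_cons, h1, h2, Multiset.count_erase_of_ne h1]

lemma P_tog {b : Multiset ℕ} {x : ℕ} (hx : 0 < x) (hP : P b x) {y : ℕ} (hy : x ≤ y) :
    P (tog b x) y ↔ P b y := by
  by_cases h : Odd (b.count (2 * x))
  · unfold P
    rw [tog_count_odd hx h, tog_count_odd hx h]
    have e1 : 2 * y ≠ x := by omega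
    rw [if_neg e1]
    by_cases h1 : y = x
    · subst h1; simp [h]
    · have e2 : ¬ (2 * y = 2 * x) := by omega
      rw [if_neg e2, if_neg h1]
      by_cases h2 : y = 2 * x
      · rw [if_pos h2]
        rw [← h2] at h
        rw [Nat.odd_iff] at h
        have : 2 ≤ b.count y - 1 ↔ 2 ≤ b.count y := by omega
        rw [this]
      · rw [if_neg h2]
  · unfold P
    rw [tog_count_even hx h, tog_count_even hx h]
    have e1 : 2 * y ≠ x := by omega
    rw [if_neg e1]
    by_cases h1 : y = x
    · subst h1
      have h3 : 2 ≤ b.count y := by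
        rcases hP with h' | h'
        · exact absurd h' h
        · exact h'
      rw [if_pos rfl]
      have : Odd (b.count (2 * y) + 1) := by
        rw [Nat.odd_iff] at *; omega
      simp [this, h3]
    · have e2 : ¬ (2 * y = 2 * x) := by omega
      rw [if_neg e2, if_neg h1]
      by_cases h2 : y = 2 * x
      · rw [if_pos h2]
        rw [← h2] at h
        rw [Nat.odd_iff] at h
        have : 2 ≤ b.count y + 1 ↔ 2 ≤ b.count y := by omega
        rw [this]
      · rw [if_neg h2]

lemma tog_tog {b : Multiset ℕ} {x : ℕ} (hx : 0 < x) (hP : P b x) : tog (tog b x) x = b := by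
  have e : 2 * x ≠ x := by omega
  ext y
  by_cases h : Odd (b.count (2 * x))
  · have h' : ¬ Odd ((tog b x).count (2 * x)) := by
      rw [tog_count_odd hx h, if_neg e, if_pos rfl]
      rw [Nat.odd_iff] at *; omega
    rw [tog_count_even hx h', tog_count_odd hx h]
    rw [Nat.odd_iff] at h
    split_ifs with h1 h2
    · omega
    · subst h2; omega
    · rfl
  · have h' : Odd ((tog b x).count (2 * x)) := by
      rw [tog_count_even hx h, if_neg e, if_pos rfl]
      rw [Nat.odd_iff] at *; omega
    rw [tog_count_odd hx h', tog_count_even hx h]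
    have h3 : 2 ≤ b.count x := by
      rcases hP with h' | h'
      · exact absurd h' h
      · exact h'
    split_ifs with h1 h2
    · subst h1; omega
    · omega
    · rfl

lemma cons_form {b : Multiset ℕ} {x : ℕ} (hx : 0 < x) (hP : P b x) :
    ∃ c : Multiset ℕ, (b = (2 * x) ::ₘ c ∧ tog b x = x ::ₘ x ::ₘ c) ∨
      (b = x ::ₘ x ::ₘ c ∧ tog b x = (2 * x) ::ₘ c) := by
  by_cases h : Odd (b.count (2 * x))
  · refine ⟨b.erase (2 * x), Or.inl ⟨?_, by rw [tog, if_pos h]⟩⟩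
    rw [Multiset.cons_erase]
    exact Multiset.count_pos.1 h.pos
  · refine ⟨(b.erase x).erase x, Or.inr ⟨?_, by rw [tog, if_neg h]⟩⟩
    have h3 : 2 ≤ b.count x := by
      rcases hP with h' | h'
      · exact absurd h' h
      · exact h'
    rw [Multiset.cons_erase, Multiset.cons_erase]
    · exact Multiset.count_pos.1 (by omega)
    · apply Multiset.count_pos.1
      rw [Multiset.count_erase_self]; omega

lemma tog_sum {b : Multiset ℕ} {x : ℕ} (hx : 0 < x) (hP : P b x) : (tog b x).sum = b.sum := by
  obtain ⟨c, ⟨h1, h2⟩ | ⟨h1, h2⟩⟩ := cons_form hx hP <;> rw [h2, h1] <;> simp <;> ring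

lemma tog_sign {b : Multiset ℕ} {x : ℕ} (hx : 0 < x) (hP : P b x) :
    (-1 : ℤ) ^ b.card + (-1) ^ (tog b x).card = 0 := by
  obtain ⟨c, ⟨h1, h2⟩ | ⟨h1, h2⟩⟩ := cons_form hx hP <;> rw [h2, h1] <;> simp [pow_succ]

lemma tog_pos {b : Multiset ℕ} {x : ℕ} (hx : 0 < x) (hP : P b x) (hb : ∀ y ∈ b, 0 < y) :
    ∀ y ∈ tog b x, 0 < y := by
  obtain ⟨c, ⟨h1, h2⟩ | ⟨h1, h2⟩⟩ := cons_form hx hP <;> rw [h2] <;> rw [h1] at hb <;>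
    simp at hb ⊢ <;> grind

lemma P_pos {b : Multiset ℕ} (hb : ∀ y ∈ b, 0 < y) {x : ℕ} (hP : P b x) : 0 < x := by
  rcases Nat.eq_zero_or_pos x with rfl | h
  · have : b.count 0 = 0 := Multiset.count_eq_zero.2 fun h => (hb 0 h).ne rfl
    simp [P, this] at hP
  · exact h

lemma P_le {b : Multiset ℕ} {x : ℕ} (hP : P b x) : x ≤ b.sum := by
  rcases hP with h | h
  · have := Multiset.le_sum_of_mem (Multiset.count_pos.1 h.pos); omega
  · exact Multiset.le_sum_of_mem (Multiset.count_pos.1 (by omega))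

open Classical in
/-- The toggle position. -/
def pos (n : ℕ) (b : Multiset ℕ) : ℕ := Nat.findGreatest (P b) n

lemma pos_spec {n : ℕ} {b : Multiset ℕ} (hn : b.sum ≤ n) (h : ∃ x, P b x) : P b (pos n b) := by
  classical
  obtain ⟨x, hx⟩ := h
  unfold pos
  exact Nat.findGreatest_spec (P := P b) ((P_le hx).trans hn) hx

lemma pos_tog {n : ℕ} {b : Multiset ℕ} (hb : ∀ y ∈ b, 0 < y) (hn : b.sum ≤ n)
    (h : ∃ x, P b x) : pos n (tog b (pos n b)) = pos n b := by
  classical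
  have hP := pos_spec hn h
  have hx := P_pos hb hP
  have hle : pos n b ≤ n := (P_le hP).trans hn
  conv_lhs => unfold pos
  rw [Nat.findGreatest_eq_iff]
  refine ⟨hle, fun _ => (P_tog hx hP le_rfl).2 hP, fun y hy hyn hPy => ?_⟩
  have hPy' := (P_tog hx hP hy.le).1 hPy
  exact Nat.findGreatest_is_greatest (P := P b) hy hyn hPy'

lemma bad_iff {b : Multiset ℕ} (hb : ∀ y ∈ b, 0 < y) :
    (¬ ∃ x, P b x) ↔ ((∀ x ∈ b, Odd x) ∧ b.Nodup) := by
  constructor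
  · intro h
    push Not at h
    refine ⟨fun y hy => ?_, ?_⟩
    · by_contra hy'
      obtain ⟨x, rfl⟩ := (Nat.not_odd_iff_even.1 hy').two_dvd
      have h1 := h x
      have h2 := h (2 * x)
      have h3 := Multiset.count_pos.2 hy
      unfold P at h1 h2
      push Not at h1 h2
      apply h1.1
      rw [Nat.odd_iff]; omega
    · rw [Multiset.nodup_iff_count_le_one]
      intro x
      have h1 := h x
      unfold P at h1
      push Not at h1
      omega
  · rintro ⟨h1, h2⟩ ⟨x, h | h⟩
    · have := h1 _ (Multiset.count_pos.1 h.pos)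
      rw [Nat.odd_iff] at this; omega
    · have := Multiset.nodup_iff_count_le_one.1 h2 x
      omega

lemma le_box {n : ℕ} {b : Multiset ℕ} (hb : ∀ y ∈ b, 0 < y) (hn : b.sum ≤ n) :
    b ≤ n • (Multiset.range (n + 1)) := by
  rw [Multiset.le_iff_count]
  intro a
  by_cases ha : a ∈ b
  · have h1 := Multiset.le_sum_of_mem ha
    have h2 : a ∈ Multiset.range (n + 1) := by simp; omega
    have h3 := Multiset.count_pos.2 h2
    have h4 : b.card ≤ b.sum := by
      have := Multiset.card_nsmul_le_sum (s := b) (a := 1) (fun y hy => hb y hy)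
      simpa using this
    have h5 := Multiset.count_le_card a b
    rw [Multiset.count_nsmul]
    nlinarith
  · simp [Multiset.count_eq_zero.2 ha]

lemma finite_GSet (n : ℕ) : (GSet n).Finite := by
  refine Set.Finite.subset ((Set.finite_Iic (n • (Multiset.range (n + 1)))).prod
    (Set.finite_Iic (n • (Multiset.range (n + 1))))) ?_
  rintro ⟨b, g⟩ ⟨h1, h2, h3, h4⟩
  have h3' : b.sum + g.sum = n := h3
  have hb : b.sum ≤ n := by omega
  have hg : g.sum ≤ n := by omega
  exact ⟨le_box h1 hb, le_box h2 hg⟩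

lemma R_sign {n : ℕ} {p : Multiset ℕ × Multiset ℕ} (hp : p ∈ RSet n) :
    (-1 : ℤ) ^ p.1.card = (-1) ^ n := by
  obtain ⟨⟨h1, h2, h3, h4⟩, h5, h6⟩ := hp
  have e1 : ∀ m : Multiset ℕ, (∀ x ∈ m, Odd x) → (-1 : ℤ) ^ m.card = (-1) ^ m.sum := by
    intro m
    induction m using Multiset.induction with
    | empty => simp
    | cons a m ih =>
      intro h
      simp only [Multiset.mem_cons, forall_eq_or_imp] at h
      rw [Multiset.card_cons, Multiset.sum_cons, pow_succ, pow_add, ih h.2, h.1.neg_one_pow]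
      ring
  have e2 : ∀ m : Multiset ℕ, (∀ x ∈ m, Even x) → (-1 : ℤ) ^ m.sum = 1 := by
    intro m
    induction m using Multiset.induction with
    | empty => simp
    | cons a m ih =>
      intro h
      simp only [Multiset.mem_cons, forall_eq_or_imp] at h
      rw [Multiset.sum_cons, pow_add, ih h.2, h.1.neg_one_pow]
      ring
  rw [← h3, pow_add, e1 _ h5, e2 _ h4, mul_one]

lemma filt_odd {p : Multiset ℕ × Multiset ℕ} (h1 : ∀ x ∈ p.1, Odd x) (h2 : ∀ x ∈ p.2, Even x) :
    (p.1 + p.2).filter (fun x => Odd x) = p.1 := by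
  rw [Multiset.filter_add, Multiset.filter_eq_self.2 h1, Multiset.filter_eq_nil.2, add_zero]
  intro x hx
  exact Nat.not_odd_iff_even.2 (h2 x hx)

lemma R_card (n : ℕ) : (RSet n).ncard = Hcount n := by
  unfold Hcount
  refine Set.ncard_congr (fun p _ => p.1 + p.2) ?_ ?_ ?_
  · rintro p ⟨⟨h1, h2, h3, h4⟩, h5, h6⟩
    refine ⟨?_, by simpa using h3, ?_⟩
    · intro x hx
      rcases Multiset.mem_add.1 hx with h | h
      · exact h1 x h
      · exact h2 x h
    · rw [filt_odd h5 h4]; exact h6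
  · rintro p q ⟨⟨-, -, -, h4⟩, h5, -⟩ ⟨⟨-, -, -, k4⟩, k5, -⟩ h
    have e : p.1 = q.1 := by rw [← filt_odd h5 h4, ← filt_odd k5 k4, h]
    rw [e] at h
    exact Prod.ext e (add_left_cancel h)
  · rintro m ⟨h1, h2, h3⟩
    refine ⟨(m.filter (fun x => Odd x), m.filter (fun x => ¬ Odd x)), ⟨⟨?_, ?_, ?_, ?_⟩, ?_, h3⟩, ?_⟩
    · intro x hx; exact h1 x (Multiset.mem_filter.1 hx).1
    · intro x hx; exact h1 x (Multiset.mem_filter.1 hx).1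
    · rw [← Multiset.sum_add, Multiset.filter_add_not]; exact h2
    · intro x hx; exact Nat.not_odd_iff_even.1 (Multiset.mem_filter.1 hx).2
    · intro x hx; exact (Multiset.mem_filter.1 hx).2
    · exact Multiset.filter_add_not _ _

end G23

/-- `G₂(n) - G₃(n) = (-1)^n * H(n)`. -/
theorem G2_sub_G3 (n : ℕ) : (G2 n : ℤ) - (G3 n : ℤ) = (-1) ^ n * (Hcount n : ℤ) := by
  classical
  set S := (G23.finite_GSet n).toFinset with hS
  have mS : ∀ p, p ∈ S ↔ p ∈ GSet n := fun p => by simp [hS]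
  have a2 : G2 n = (S.filter (fun p => Even p.1.card)).card := by
    rw [G2, ← Set.ncard_coe_finset]; congr 1; ext p; simp [mS]
  have a3 : G3 n = (S.filter (fun p => ¬ Even p.1.card)).card := by
    rw [G3, ← Set.ncard_coe_finset]; congr 1; ext p; simp [mS]
  have aR : Hcount n = (S.filter (fun p => ¬ ∃ x, G23.P p.1 x)).card := by
    rw [← G23.R_card, ← Set.ncard_coe_finset]; congr 1; ext p
    simp only [Finset.coe_filter, mS, Set.mem_setOf_eq, RSet]
    constructor
    · rintro ⟨h1, h2⟩
      exact ⟨h1, (G23.bad_iff h1.1).2 h2⟩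
    · rintro ⟨h1, h2⟩
      exact ⟨h1, (G23.bad_iff h1.1).1 h2⟩
  have s1 : ∑ p ∈ S, (-1 : ℤ) ^ p.1.card = G2 n - G3 n := by
    rw [← Finset.sum_filter_add_sum_filter_not S (fun p => Even p.1.card), a2, a3, sub_eq_add_neg]
    congr 1
    · rw [Finset.sum_congr rfl (g := fun _ => (1 : ℤ))]
      · simp
      · intro p hp; exact (Finset.mem_filter.1 hp).2.neg_one_pow
    · rw [Finset.sum_congr rfl (g := fun _ => (-1 : ℤ))]
      · simp
      · intro p hp; exact (Nat.not_even_iff_odd.1 (Finset.mem_filter.1 hp).2).neg_one_pow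
  rw [← s1, ← Finset.sum_filter_add_sum_filter_not S (fun p => ∃ x, G23.P p.1 x), aR]
  have z : ∑ p ∈ S.filter (fun p => ∃ x, G23.P p.1 x), (-1 : ℤ) ^ p.1.card = 0 := by
    have key : ∀ p ∈ S.filter (fun p => ∃ x, G23.P p.1 x),
        p ∈ GSet n ∧ p.1.sum ≤ n ∧ (∃ x, G23.P p.1 x) ∧ G23.P p.1 (G23.pos n p.1) ∧
          0 < G23.pos n p.1 := by
      intro p hp
      rw [Finset.mem_filter, mS] at hp
      have h3 := hp.1.2.2.1
      have hle : p.1.sum ≤ n := by omega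
      have hP := G23.pos_spec hle hp.2
      exact ⟨hp.1, hle, hp.2, hP, G23.P_pos hp.1.1 hP⟩
    refine Finset.sum_involution (fun p _ => (G23.tog p.1 (G23.pos n p.1), p.2)) ?_ ?_ ?_ ?_
    · intro p hp
      obtain ⟨h1, h2, h3, h4, h5⟩ := key p hp
      exact G23.tog_sign h5 h4
    · intro p hp _ h
      obtain ⟨h1, h2, h3, h4, h5⟩ := key p hp
      have := G23.tog_sign h5 h4
      have h6 : G23.tog p.1 (G23.pos n p.1) = p.1 := congrArg Prod.fst h
      rw [h6] at this
      have h0 : (-1 : ℤ) ^ p.1.card ≠ 0 := by simp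
      omega
    · intro p hp
      obtain ⟨h1, h2, h3, h4, h5⟩ := key p hp
      rw [Finset.mem_filter, mS]
      refine ⟨⟨G23.tog_pos h5 h4 h1.1, h1.2.1, ?_, h1.2.2.2⟩, _, (G23.P_tog h5 h4 le_rfl).2 h4⟩
      rw [G23.tog_sum h5 h4]
      exact h1.2.2.1
    · intro p hp
      obtain ⟨h1, h2, h3, h4, h5⟩ := key p hp
      simp only [G23.pos_tog h1.1 h2 h3, G23.tog_tog h5 h4]
  rw [z, zero_add, Finset.sum_congr rfl (g := fun _ => (-1 : ℤ) ^ n)]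
  · simp [mul_comm]
  · intro p hp
    rw [Finset.mem_filter, mS] at hp
    exact G23.R_sign ⟨hp.1, (G23.bad_iff hp.1.1).1 hp.2⟩
end
end

section
/- For every nonnegative integer n, L_0(n) - L_1(n) equals 1 if n is a triangular number (that is, n = k(k+1)/2 for some nonnegative integer k) and equals 0 otherwise, where L_0(n) (resp. L_1(n)) counts the partitions counted by L(n) with an even (resp. odd) number of blue even parts. -/
noncomputable section

section LLhelpers
open Finset Polynomial

def LLB {R : Type*} [CommRing R] (x : R) (n : ℕ) : R := ∏ i ∈ range n, (1 - x ^ (2*i+1))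
def LLC {R : Type*} [CommRing R] (x : R) (s n : ℕ) : R := ∏ i ∈ Ico s n, (1 - x ^ (2*i+2))
def LLU {R : Type*} [CommRing R] (x : R) (n : ℕ) : R := ∏ i ∈ range n, ((1 + x ^ (2*i+1)) * (1 + x ^ (2*i+2)))

lemma LLB_succ {R : Type*} [CommRing R] (x : R) (n : ℕ) : LLB x (n+1) = LLB x n * (1 - x^(2*n+1)) := by
  simp [LLB, prod_range_succ]

lemma LLC_succ {R : Type*} [CommRing R] (x : R) (s n : ℕ) (h : s ≤ n) :
    LLC x s (n+1) = LLC x s n * (1 - x^(2*n+2)) := by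
  simp [LLC, prod_Ico_succ_top h]

lemma LLC_left {R : Type*} [CommRing R] (x : R) (s n : ℕ) (h : s < n) :
    LLC x s n = (1 - x^(2*s+2)) * LLC x (s+1) n := by
  simp [LLC, prod_eq_prod_Ico_succ_bot h]

lemma LLpart {R : Type*} [CommRing R] (x : R) (n m : ℕ) (hm : m ≤ n) :
    ∑ s ∈ range (m+1), (LLC x s (n+1) * LLB x s * x^(s*(2*n+3))
      - (1 - x^(2*n+1)) * (LLC x s n * LLB x s * x^(s*(2*n+1))))
     = LLC x m n * LLB x (m+1) * x^((m+1)*(2*n+1)) := by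
  induction m with
  | zero =>
    rw [sum_range_one, LLC_succ x 0 n hm, LLB_succ]
    simp [LLB]
    ring
  | succ m ih =>
    rw [sum_range_succ, ih (by omega), LLC_succ x _ n hm, LLB_succ x (m+1), LLC_left x m n hm]
    ring

lemma LLshanks {R : Type*} [CommRing R] (x : R) (n : ℕ) :
    ∑ s ∈ range (n+1), LLC x s n * LLB x s * x^(s*(2*n+1))
     = LLB x n * ∑ t ∈ range (2*n+1), x^(t*(t+1)/2) := by
  induction n with
  | zero => simp [LLC, LLB]
  | succ n ih =>
    have h := LLpart x n n le_rfl
    rw [sum_sub_distrib, ← mul_sum, ih, sub_eq_iff_eq_add] at h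
    rw [sum_range_succ]
    have e : 2*(n+1)+1 = 2*n+3 := by ring
    have e3 : ∑ t ∈ range (2*n+3), x^(t*(t+1)/2) = ∑ t ∈ range (2*n+1), x^(t*(t+1)/2)
        + x^((2*n+1)*(2*n+1+1)/2) + x^((2*n+1+1)*(2*n+1+1+1)/2) := by
      rw [sum_range_succ, sum_range_succ]
    rw [e, h, e3, LLB_succ]
    have e1 : (2*n+1)*(2*n+1+1)/2 = (n+1)*(2*n+1) := by
      rw [show (2*n+1)*(2*n+1+1) = (n+1)*(2*n+1)*2 by ring]; simp
    have e2 : (2*n+1+1)*(2*n+1+1+1)/2 = (n+1)*(2*n+3) := by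
      rw [show (2*n+1+1)*(2*n+1+1+1) = (n+1)*(2*n+3)*2 by ring]; simp
    rw [e1, e2]
    simp [LLC]
    ring

lemma LLBU {R : Type*} [CommRing R] (x : R) (n : ℕ) :
    LLB x n * LLU x n = LLC x n (2*n) := by
  induction n with
  | zero => simp [LLB, LLU, LLC]
  | succ n ih =>
    have h : LLU x (n+1) = LLU x n * ((1 + x ^ (2*n+1)) * (1 + x ^ (2*n+2))) := by
      simp [LLU, prod_range_succ]
    have h2 : LLC x (n+1) (2*(n+1)) * (1 - x^(2*n+2)) = LLC x n (2*n) * (1 - x^(4*n+2)) * (1-x^(4*n+4)) := by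
      rw [mul_comm, ← LLC_left x n _ (by omega), show 2*(n+1) = 2*n+1+1 by ring,
        LLC_succ x _ _ (by omega), LLC_succ x _ _ (by omega)]
      ring_nf
    rw [LLB_succ, h]
    have h3 : LLC x (n+1) (2*(n+1)) = LLC x n (2*n) * (1 - x^(4*n+2)) * (1+x^(2*n+2)) := by
      rcases Nat.eq_zero_or_pos n with rfl | hn
      · simp [LLC]; ring
      · rw [show 2*(n+1) = 2*n+1+1 by ring,
        LLC_succ x _ _ (by omega), LLC_succ x _ _ (by omega), LLC_left x n (2*n) (by omega)]
        ring
    rw [h3, ← ih]; ring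

lemma LLCmod {R : Type*} [CommRing R] (x : R) (s n k : ℕ) (hk : k ≤ 2*s+2) :
    x^k ∣ LLC x s n - 1 := by
  unfold LLC
  induction n with
  | zero => simp
  | succ n ih =>
    by_cases h : s ≤ n
    · rw [prod_Ico_succ_top h]
      have : x^k ∣ x^(2*n+2) := pow_dvd_pow _ (by omega)
      have := (ih.mul_right (1 - x^(2*n+2))).sub this
      convert this using 1; ring
    · rw [Ico_eq_empty (by omega)]; simp

lemma LLmain {R : Type*} [CommRing R] (x : R) (n : ℕ) :
    x^(2*n+1) ∣ LLC x 0 n * LLU x n - ∑ t ∈ range (2*n+1), x^(t*(t+1)/2) := by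
  have h := LLshanks x n
  rw [sum_range_succ'] at h
  have h1 : x^(2*n+1) ∣ ∑ s ∈ range n, LLC x (s+1) n * LLB x (s+1) * x^((s+1)*(2*n+1)) :=
    dvd_sum fun s _ => Dvd.dvd.mul_left (pow_dvd_pow _ (by nlinarith)) _
  have h2 := LLCmod x n (2*n) (2*n+1) (by omega)
  rw [← LLBU] at h2
  have h3 := (h2.mul_right (∑ t ∈ range (2*n+1), x^(t*(t+1)/2))).sub (h1.mul_right (LLU x n))
  convert h3 using 1
  have h4 : LLC x 0 n = LLB x n * ∑ t ∈ range (2*n+1), x^(t*(t+1)/2) - 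
     ∑ s ∈ range n, LLC x (s+1) n * LLB x (s+1) * x^((s+1)*(2*n+1)) := by
    rw [← h]; simp [LLB]
  rw [h4]; ring

def LLe (i : ℕ) : ℤ := if Even i then -1 else 1

lemma LLprod1 (n : ℕ) : (∏ i ∈ Icc 1 (2*n), (1 + C (LLe i) * (X:ℤ[X])^i)) *
    (∏ i ∈ (Icc 1 (2*n)).filter Even, (1 + (X:ℤ[X])^i)) = LLC X 0 n * LLU X n := by
  rw [prod_filter]
  induction n with
  | zero => simp [LLC, LLU]
  | succ n ih =>
    rw [show 2*(n+1) = 2*n+1+1 by ring, prod_Icc_succ_top (by omega), prod_Icc_succ_top (by omega),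
      prod_Icc_succ_top (by omega), prod_Icc_succ_top (by omega), LLC_succ X 0 n (by omega)]
    have h : LLU (X:ℤ[X]) (n+1) = LLU X n * ((1 + X ^ (2*n+1)) * (1 + X ^ (2*n+2))) := by
      simp [LLU, prod_range_succ]
    have o1 : ¬ Even (2*n+1) := by simp
    have o2 : Even (2*n+1+1) := by grind
    rw [h]
    simp only [LLe, o1, o2, if_true, if_false]
    have := congrArg (fun p => p * ((1 - (X:ℤ[X])^(2*n+2)) * ((1 + X ^ (2*n+1)) * (1 + X ^ (2*n+2))))) ih
    simp only [LLe] at this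
    simp only [map_neg, map_one]
    linear_combination this

lemma LLprod2 (n : ℕ) : (∏ i ∈ Icc 1 (2*n), (1 + C (LLe i) * (X:ℤ[X])^i)) *
    (∏ i ∈ (Icc 1 (2*n)).filter Even, (1 + (X:ℤ[X])^i)) =
    ∑ p ∈ (Icc 1 (2*n)).powerset ×ˢ ((Icc 1 (2*n)).filter Even).powerset,
      C ((-1)^(p.1.filter (fun x => Even x)).card) * X^(p.1.sum id + p.2.sum id) := by
  rw [prod_one_add, prod_one_add, sum_mul_sum, ← sum_product']
  refine sum_congr rfl fun p _ => ?_
  rw [prod_mul_distrib, prod_pow_eq_pow_sum, prod_pow_eq_pow_sum, ← map_prod, pow_add]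
  simp only [LLe, prod_ite, prod_const, id, one_pow, mul_one, mul_assoc]

lemma LLcoeff (n : ℕ) : 
    (∑ p ∈ (Icc 1 (2*n)).powerset ×ˢ ((Icc 1 (2*n)).filter Even).powerset with p.1.sum id + p.2.sum id = n,
      (-1 : ℤ)^(p.1.filter (fun x => Even x)).card) = ∑ t ∈ range (2*n+1), if n = t*(t+1)/2 then (1:ℤ) else 0 := by
  have h := LLmain (X:ℤ[X]) n
  rw [← LLprod1, LLprod2, X_pow_dvd_iff] at h
  have := h n (by omega)
  rw [coeff_sub, sub_eq_zero] at this
  simp only [finsetSum_coeff, coeff_X_pow, coeff_C_mul, mul_ite, mul_one, mul_zero] at this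
  rw [← this, sum_filter]
  exact sum_congr rfl fun p _ => by simp only [eq_comm]

lemma LLrhs (n : ℕ) [Decidable (∃ k : ℕ, n = k * (k + 1) / 2)] : (∑ t ∈ range (2*n+1), if n = t*(t+1)/2 then (1:ℤ) else 0) = 
    if ∃ k : ℕ, n = k * (k + 1) / 2 then 1 else 0 := by
  have key : ∀ k, k*(k+1)/2*2 = k*(k+1) := fun k => Nat.div_mul_cancel (Nat.even_mul_succ_self k).two_dvd
  split_ifs with h
  · obtain ⟨k, hk⟩ := h
    have hk2 := key k
    rw [← hk] at hk2
    rw [sum_eq_single_of_mem k, if_pos hk]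
    · rw [mem_range]; nlinarith
    · intro b _ hb
      rw [if_neg]
      intro hb'
      have := key b
      rw [← hb'] at this
      rcases lt_or_gt_of_ne hb with h | h <;> nlinarith
  · refine sum_eq_zero fun t _ => ?_
    rw [if_neg fun ht => h ⟨t, ht⟩]

lemma LLset (n : ℕ) (p : Finset ℕ × Finset ℕ) : p ∈ LSet n ↔
    p ∈ ((Icc 1 (2*n)).powerset ×ˢ ((Icc 1 (2*n)).filter Even).powerset).filter
      (fun p => p.1.sum id + p.2.sum id = n) := by
  simp only [LSet, Set.mem_setOf_eq, mem_filter, mem_product, mem_powerset]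
  constructor
  · rintro ⟨h1, h2, h3⟩
    refine ⟨⟨fun x hx => ?_, fun x hx => ?_⟩, h3⟩
    · have := single_le_sum (f := id) (fun _ _ => Nat.zero_le _) hx
      have := h1 x hx
      simp only [id, mem_Icc] at *
      omega
    · have := single_le_sum (f := id) (fun _ _ => Nat.zero_le _) hx
      have := h2 x hx
      simp only [id, mem_Icc, mem_filter] at *
      refine ⟨by omega, (h2 x hx).2⟩
  · rintro ⟨⟨h1, h2⟩, h3⟩
    refine ⟨fun x hx => ?_, fun x hx => ?_, h3⟩
    · have := mem_Icc.1 (h1 hx)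
      omega
    · have := mem_filter.1 (h2 hx)
      have h := mem_Icc.1 this.1
      exact ⟨by omega, this.2⟩

lemma LLfinal (n : ℕ) : (L0 n : ℤ) - (L1 n : ℤ) =
    ∑ t ∈ range (2*n+1), if n = t*(t+1)/2 then (1:ℤ) else 0 := by
  rw [← LLcoeff]
  set S := ((Icc 1 (2*n)).powerset ×ˢ ((Icc 1 (2*n)).filter Even).powerset).filter
      (fun p => p.1.sum id + p.2.sum id = n) with hS
  have h0 : L0 n = (S.filter (fun p => Even (p.1.filter (fun x => Even x)).card)).card := by
    rw [L0, ← Set.ncard_coe_finset]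
    congr 1
    ext p
    simp only [Set.mem_setOf_eq, LLset, mem_coe, mem_filter, ← hS]
  have h1 : L1 n = (S.filter (fun p => ¬ Even (p.1.filter (fun x => Even x)).card)).card := by
    rw [L1, ← Set.ncard_coe_finset]
    congr 1
    ext p
    simp only [Set.mem_setOf_eq, LLset, mem_coe, mem_filter, ← hS, Nat.not_even_iff_odd]
  rw [h0, h1, ← sum_filter_add_sum_filter_not S
    (fun p => Even (p.1.filter (fun x => Even x)).card)]
  rw [sum_congr rfl (g := fun _ => (1:ℤ)) fun p hp => (mem_filter.1 hp).2.neg_one_pow,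
    sum_congr rfl (s₁ := S.filter (fun p => ¬ Even (p.1.filter (fun x => Even x)).card))
      (g := fun _ => (-1:ℤ)) fun p hp =>
      (Nat.not_even_iff_odd.1 (mem_filter.1 hp).2).neg_one_pow]
  simp
  ring

end LLhelpers

open scoped Classical

/-- `L₀(n) - L₁(n)` is `1` if `n` is triangular and `0` otherwise. -/
theorem L0_sub_L1 (n : ℕ) :
    (L0 n : ℤ) - (L1 n : ℤ) =
      if ∃ k : ℕ, n = k * (k + 1) / 2 then 1 else 0 := by
  rw [LLfinal, LLrhs]
end
end

section
/- For every nonnegative integer n, L_2(n) - L_3(n) equals (-1)^n if n is a triangular number (that is, n = k(k+1)/2 for some nonnegative integer k) and equals 0 otherwise, where L_2(n) (resp. L_3(n)) counts the partitions counted by L(n) with an even (resp. odd) number of blue parts. -/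
noncomputable section

section helpers
open Finset

def shC {R : Type*} [CommRing R] (x : R) (s n : ℕ) : R := ∏ i ∈ Finset.Ico s n, (1 - x ^ (2 * i + 2))
def shD {R : Type*} [CommRing R] (x : R) (n : ℕ) : R := ∏ i ∈ Finset.range n, (1 - x ^ (2 * i + 1))
def shT (s : ℕ) : ℕ := ∑ i ∈ Finset.range (s + 1), i
def shS {R : Type*} [CommRing R] (x : R) (n : ℕ) : R := ∑ s ∈ Finset.range (2 * n), x ^ (shT s)
def shE {R : Type*} [CommRing R] (x : R) (n : ℕ) : R :=
  ∑ s ∈ Finset.range n, x ^ (s * (2 * n + 1)) * shD x s * shC x s n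

theorem shT_eq (s : ℕ) : shT s = s * (s + 1) / 2 := by
  rw [shT, Finset.sum_range_id]; simp [mul_comm]

theorem shT_even (n : ℕ) : shT (2 * n) = n * (2 * n + 1) := by
  rw [shT_eq, mul_assoc]; simp

theorem shT_succ (n : ℕ) : shT (n + 1) = shT n + (n + 1) := by
  rw [shT, Finset.sum_range_succ]; rfl

theorem shTel {R : Type*} [CommRing R] (x : R) (n m : ℕ) (hm : m ≤ n) :
    ∑ s ∈ Finset.range m, (x ^ (s * (2 * (n + 1) + 1)) * shD x s * shC x s (n + 1)
      - (1 - x ^ (2 * n + 1)) * (x ^ (s * (2 * n + 1)) * shD x s * shC x s n))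
      = (1 - x ^ (2 * m)) * x ^ (m * (2 * n + 1)) * shD x m * shC x m n := by
  induction m with
  | zero => simp
  | succ m ih =>
    rw [Finset.sum_range_succ, ih (by omega)]
    have h1 : shC x m (n + 1) = shC x m n * (1 - x ^ (2 * n + 2)) := by
      rw [shC, Finset.prod_Ico_succ_top (by omega)]; rfl
    have h2 : shC x m n = (1 - x ^ (2 * m + 2)) * shC x (m + 1) n := by
      rw [shC, Finset.prod_eq_prod_Ico_succ_bot (by omega)]; rfl
    have h3 : shD x (m + 1) = shD x m * (1 - x ^ (2 * m + 1)) := by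
      rw [shD, Finset.prod_range_succ]; rfl
    rw [h1, h2, h3]
    ring

theorem shE_succ {R : Type*} [CommRing R] (x : R) (n : ℕ) :
    shE x (n + 1) = (1 - x ^ (2 * n + 1)) * shE x n
      + shD x n * x ^ (shT (2 * n)) * (1 - x ^ (4 * n + 2)) := by
  have h := shTel x n n le_rfl
  rw [Finset.sum_sub_distrib, ← Finset.mul_sum] at h
  rw [shE, Finset.sum_range_succ, shE, shT_even]
  have h1 : shC x n (n + 1) = 1 - x ^ (2 * n + 2) := by simp [shC]
  have h2 : shC x n n = 1 := by simp [shC]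
  rw [h2] at h
  rw [h1]
  linear_combination h

theorem shS_mul {R : Type*} [CommRing R] (x : R) (n : ℕ) : shS x n * shD x n = shE x n := by
  induction n with
  | zero => simp [shS, shE]
  | succ n ih =>
    rw [shE_succ, ← ih]
    have h1 : shS x (n + 1) = shS x n + x ^ (shT (2 * n)) + x ^ (shT (2 * n) + (2 * n + 1)) := by
      rw [shS, show 2 * (n + 1) = 2 * n + 1 + 1 by ring, Finset.sum_range_succ,
        Finset.sum_range_succ, shT_succ]; rfl
    have h3 : shD x (n + 1) = shD x n * (1 - x ^ (2 * n + 1)) := by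
      rw [shD, Finset.prod_range_succ]; rfl
    rw [h1, h3]
    ring

theorem shE_dvd {R : Type*} [CommRing R] (x : R) (n : ℕ) (hn : 0 < n) :
    x ^ (2 * n + 1) ∣ shE x n - shC x 0 n := by
  obtain ⟨k, rfl⟩ : ∃ k, n = k + 1 := ⟨n - 1, by omega⟩
  rw [shE, Finset.sum_range_succ']
  simp only [shD, Finset.range_zero, Finset.prod_empty, zero_mul, pow_zero, one_mul,
    add_sub_cancel_right]
  refine Finset.dvd_sum fun i _ => ?_
  rw [mul_assoc]
  exact Dvd.dvd.mul_right (pow_dvd_pow _ (by nlinarith)) _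

theorem tail_dvd {R : Type*} [CommRing R] (x : R) (n m : ℕ) (hm : n ≤ m) :
    x ^ (2 * n + 1) ∣ shC x 0 m - shC x 0 n := by
  induction m, hm using Nat.le_induction with
  | base => simp
  | succ m hm ih =>
    have h1 : shC x 0 (m + 1) = shC x 0 m * (1 - x ^ (2 * m + 2)) := by
      rw [shC, Finset.prod_Ico_succ_top (by omega)]; rfl
    rw [h1, show shC x 0 m * (1 - x ^ (2 * m + 2)) - shC x 0 n
      = (shC x 0 m - shC x 0 n) - x ^ (2 * m + 2) * shC x 0 m by ring]
    exact dvd_sub ih (Dvd.dvd.mul_right (pow_dvd_pow _ (by omega)) _)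

def shA {R : Type*} [CommRing R] (q : R) (n : ℕ) : R :=
  (∏ i ∈ Finset.range (2 * n), (1 - q ^ (i + 1))) * ∏ i ∈ Finset.range n, (1 + q ^ (2 * i + 2))

theorem shA_mul {R : Type*} [CommRing R] (q : R) (n : ℕ) :
    shA q n * shD (-q) n = shC (-q) 0 (2 * n) := by
  induction n with
  | zero => simp [shA, shD, shC]
  | succ n ih =>
    have e : ∀ m, shC (-q) 0 (m + 1) = shC (-q) 0 m * (1 - q ^ (2 * m + 2)) := by
      intro m
      rw [shC, Finset.prod_Ico_succ_top (by omega), Even.neg_pow ⟨m + 1, by ring⟩]; rfl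
    have h3 : shD (-q) (n + 1) = shD (-q) n * (1 + q ^ (2 * n + 1)) := by
      rw [shD, Finset.prod_range_succ, Odd.neg_pow ⟨n, rfl⟩, sub_neg_eq_add]; rfl
    have h4 : shA q (n + 1) = shA q n *
        ((1 - q ^ (2 * n + 1)) * (1 - q ^ (2 * n + 2)) * (1 + q ^ (2 * n + 2))) := by
      rw [shA, show 2 * (n + 1) = 2 * n + 1 + 1 by ring, Finset.prod_range_succ,
        Finset.prod_range_succ, Finset.prod_range_succ, shA]; ring
    rw [show 2 * (n + 1) = 2 * n + 1 + 1 by ring, e, e, ← ih, h3, h4]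
    ring

open Polynomial in
theorem shA_dvd (n : ℕ) (hn : 0 < n) :
    (X : ℤ[X]) ^ (2 * n + 1) ∣ shA X n - shS (-X) n := by
  have h : (X : ℤ[X]) ^ (2 * n + 1) ∣ shD (-X) n * (shA X n - shS (-X) n) := by
    have h1 := shE_dvd (-X : ℤ[X]) n hn
    have h2 := tail_dvd (-X : ℤ[X]) n (2 * n) (by omega)
    rw [Odd.neg_pow ⟨n, rfl⟩, neg_dvd] at h1 h2
    have h3 := dvd_sub h2 h1
    rw [← shA_mul, ← shS_mul] at h3
    convert h3 using 1
    ring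
  refine IsCoprime.dvd_of_dvd_mul_left (IsCoprime.pow_left ?_) h
  refine IsCoprime.prod_right fun i _ => ?_
  refine ⟨-X ^ (2 * i), 1, ?_⟩
  rw [Odd.neg_pow ⟨i, rfl⟩]
  ring

open Polynomial in
theorem coeff_shS (n N : ℕ) [Decidable (∃ k : ℕ, n = k * (k + 1) / 2)] (hN : n < 2 * N) :
    (shS (-X : ℤ[X]) N).coeff n =
      if ∃ k : ℕ, n = k * (k + 1) / 2 then (-1) ^ n else 0 := by
  have hmono : StrictMono shT := strictMono_nat_of_lt_succ fun k => by rw [shT_succ]; omega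
  have hc : ∀ k, ((-X : ℤ[X]) ^ (shT k)).coeff n = if n = shT k then (-1) ^ n else 0 := by
    intro k
    rw [neg_pow, show ((-1 : ℤ[X]) ^ (shT k)) = C ((-1) ^ (shT k)) by simp, coeff_C_mul,
      coeff_X_pow]
    split_ifs with h <;> simp [h]
  simp only [shS, finsetSum_coeff, hc]
  split_ifs with h
  · obtain ⟨k, hk⟩ := h
    rw [← shT_eq] at hk
    subst hk
    rw [Finset.sum_eq_single k]
    · simp
    · intro b _ hb
      rw [if_neg]
      exact fun h => hb (hmono.injective h).symm
    · intro hk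
      have := hmono.le_apply (x := k)
      simp at hk
      omega
  · exact Finset.sum_eq_zero fun k _ => if_neg fun hk => h ⟨k, hk.trans (shT_eq k)⟩

def blueF (N : ℕ) : Finset ℕ := (Finset.range (2 * N)).image (fun i => i + 1)
def greenF (N : ℕ) : Finset ℕ := (Finset.range N).image (fun i => 2 * i + 2)

def LF (n N : ℕ) : Finset (Finset ℕ × Finset ℕ) :=
  ((blueF N).powerset ×ˢ (greenF N).powerset).filter (fun p => p.1.sum id + p.2.sum id = n)

theorem LSet_eq (n N : ℕ) (h : n ≤ 2 * N) : LSet n = (LF n N : Set (Finset ℕ × Finset ℕ)) := by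
  ext ⟨s, t⟩
  simp only [LSet, LF, Set.mem_ofPred_eq, Finset.coe_filter, Finset.mem_product,
    Finset.mem_powerset]
  constructor
  · rintro ⟨h1, h2, h3⟩
    refine ⟨⟨fun x hx => ?_, fun x hx => ?_⟩, h3⟩
    · have := Finset.single_le_sum (f := id) (fun i _ => Nat.zero_le _) hx
      have := h1 x hx
      simp only [id] at *
      simp only [blueF, Finset.mem_image, Finset.mem_range]
      exact ⟨x - 1, by omega, by omega⟩
    · have := Finset.single_le_sum (f := id) (fun i _ => Nat.zero_le _) hx
      obtain ⟨h4, k, hk⟩ := h2 x hx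
      simp only [id] at *
      simp only [greenF, Finset.mem_image, Finset.mem_range]
      exact ⟨k - 1, by omega, by omega⟩
  · rintro ⟨⟨h1, h2⟩, h3⟩
    refine ⟨fun x hx => ?_, fun x hx => ?_, h3⟩
    · have := h1 hx
      simp only [blueF, Finset.mem_image, Finset.mem_range] at this
      omega
    · have := h2 hx
      simp only [greenF, Finset.mem_image, Finset.mem_range] at this
      obtain ⟨k, _, rfl⟩ := this
      exact ⟨by omega, k + 1, by ring⟩

open Polynomial in
theorem shA_expand (N : ℕ) : shA (X : ℤ[X]) N =
    ∑ p ∈ (blueF N).powerset ×ˢ (greenF N).powerset,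
      C ((-1) ^ p.1.card) * X ^ (p.1.sum id + p.2.sum id) := by
  have hb : ∏ i ∈ Finset.range (2 * N), (1 - (X : ℤ[X]) ^ (i + 1))
      = ∏ i ∈ blueF N, (1 + (-1) * (X : ℤ[X]) ^ i) := by
    rw [blueF, Finset.prod_image (fun a _ b _ h => by simpa using h)]
    exact Finset.prod_congr rfl fun i _ => by ring
  have hg : ∏ i ∈ Finset.range N, (1 + (X : ℤ[X]) ^ (2 * i + 2))
      = ∏ i ∈ greenF N, (1 + (X : ℤ[X]) ^ i) := by
    rw [greenF, Finset.prod_image (fun a _ b _ h => by simpa using h)]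
  rw [shA, hb, hg, Finset.prod_one_add, Finset.prod_one_add, Finset.sum_mul_sum,
    Finset.sum_product]
  refine Finset.sum_congr rfl fun s _ => Finset.sum_congr rfl fun t _ => ?_
  rw [Finset.prod_mul_distrib, Finset.prod_const, Finset.prod_pow_eq_pow_sum,
    Finset.prod_pow_eq_pow_sum, pow_add]
  simp [mul_assoc]

open Polynomial in
theorem L_eq (n N : ℕ) (h : n ≤ 2 * N) :
    (L2 n : ℤ) - (L3 n : ℤ) = (shA (X : ℤ[X]) N).coeff n := by
  have h2 : L2 n = ((LF n N).filter (fun p => Even p.1.card)).card := by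
    rw [L2, LSet_eq n N h, ← Set.ncard_coe_finset]; congr 1; ext; simp
  have h3 : L3 n = ((LF n N).filter (fun p => ¬ Even p.1.card)).card := by
    rw [L3, LSet_eq n N h, ← Set.ncard_coe_finset]; congr 1; ext; simp
  have h4 : (shA (X : ℤ[X]) N).coeff n = ∑ p ∈ LF n N, (-1) ^ p.1.card := by
    rw [shA_expand, finsetSum_coeff, LF, Finset.sum_filter]
    refine Finset.sum_congr rfl fun p _ => ?_
    rw [coeff_C_mul, coeff_X_pow]
    simp [eq_comm]
  rw [h4, ← Finset.sum_filter_add_sum_filter_not _ (fun p => Even p.1.card), h2, h3,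
    Finset.sum_congr rfl (g := fun _ => (1 : ℤ)),
    Finset.sum_congr (s₁ := (LF n N).filter (fun p => ¬ Even p.1.card)) rfl (g := fun _ => (-1 : ℤ))]
  · simp [sub_eq_add_neg]
  · intro p hp
    exact Odd.neg_one_pow (Nat.not_even_iff_odd.mp (Finset.mem_filter.mp hp).2)
  · intro p hp
    exact Even.neg_one_pow (Finset.mem_filter.mp hp).2

end helpers

open scoped Classical

/-- `L₂(n) - L₃(n)` is `(-1)^n` if `n` is triangular and `0` otherwise. -/
theorem L2_sub_L3 (n : ℕ) :
    (L2 n : ℤ) - (L3 n : ℤ) =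
      if ∃ k : ℕ, n = k * (k + 1) / 2 then (-1) ^ n else 0 := by 
  have h := shA_dvd (n + 1) (by omega)
  rw [Polynomial.X_pow_dvd_iff] at h
  have h1 := h n (by omega)
  rw [Polynomial.coeff_sub, sub_eq_zero] at h1
  rw [L_eq n (n + 1) (by omega), h1, coeff_shS n (n + 1) (by omega)]
end
end
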